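/- Let p > 2 and let q = p/(p−1) be the Hölder conjugate of p. There exists a constant C > 0 such that for every ε > 0 and every smooth compactly supported f: ℝ³ → ℝ, the q-super-Poincaré inequality ∫ |f|^q dμ ≤ ε ∫ |∇_ℍ f|^q dμ + exp(C(1 + ε^{−2(p−1)/(p−2)})) (∫ |f|^{q/2} dμ)² holds, where |∇_ℍ f|^q = ((X₁f)² + (X₂f)²)^{q/2}. -/

import Mathlib

open MeasureTheory

/-- Horizontal vector field `X₁ = ∂_{x₁} - (x₂/2) ∂_t` on the Heisenberg group `ℝ³`. -/
noncomputable def X1 (f : ℝ × ℝ × ℝ → ℝ) (w : ℝ × ℝ × ℝ) : ℝ :=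
  fderiv ℝ f w (1, 0, -(w.2.1) / 2)

/-- Horizontal vector field `X₂ = ∂_{x₂} + (x₁/2) ∂_t` on the Heisenberg group `ℝ³`. -/
noncomputable def X2 (f : ℝ × ℝ × ℝ → ℝ) (w : ℝ × ℝ × ℝ) : ℝ :=
  fderiv ℝ f w (0, 1, w.1 / 2)

/-- The Kaplan norm `N(x₁,x₂,t) = ((x₁² + x₂²)² + 16 t²)^{1/4}` on the Heisenberg group. -/
noncomputable def KaplanH (w : ℝ × ℝ × ℝ) : ℝ :=
  ((w.1 ^ 2 + w.2.1 ^ 2) ^ 2 + 16 * w.2.2 ^ 2) ^ ((1 : ℝ) / 4)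

/-- The probability measure `dμ = Z⁻¹ e^{-N^p} dξ` on the Heisenberg group `ℝ³`. -/
noncomputable def muH (p : ℝ) : Measure (ℝ × ℝ × ℝ) :=
  volume.withDensity (fun w => ENNReal.ofReal
    ((∫ v : ℝ × ℝ × ℝ, Real.exp (-(KaplanH v) ^ p))⁻¹ * Real.exp (-(KaplanH w) ^ p)))

open Set

/-- The quantity `1 + N⁴`, with `N` the Kaplan norm. -/
noncomputable def gaugeK (w : ℝ × ℝ × ℝ) : ℝ :=
  1 + ((w.1 ^ 2 + w.2.1 ^ 2) ^ 2 + 16 * w.2.2 ^ 2)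

lemma one_le_gaugeK (w : ℝ × ℝ × ℝ) : 1 ≤ gaugeK w := by
  unfold gaugeK; nlinarith [sq_nonneg (w.1 ^ 2 + w.2.1 ^ 2), sq_nonneg w.2.2]

/-- The flow of the horizontal field `X1`. -/
noncomputable def flowX1 (a : ℝ) (w : ℝ × ℝ × ℝ) : ℝ × ℝ × ℝ :=
  (w.1 + a, w.2.1, w.2.2 - a * w.2.1 / 2)

/-- The flow of the horizontal field `X2`. -/
noncomputable def flowX2 (a : ℝ) (w : ℝ × ℝ × ℝ) : ℝ × ℝ × ℝ :=
  (w.1, w.2.1 + a, w.2.2 + a * w.1 / 2)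

lemma continuous_flowX1 : Continuous (Function.uncurry flowX1) := by
  unfold Function.uncurry flowX1; fun_prop

lemma continuous_flowX2 : Continuous (Function.uncurry flowX2) := by
  unfold Function.uncurry flowX2; fun_prop

lemma lintegral_triple {g : ℝ × ℝ × ℝ → ENNReal} (hg : Measurable g) :
    ∫⁻ w, g w = ∫⁻ x, ∫⁻ y, ∫⁻ t, g (x, y, t) := by
  rw [Measure.volume_eq_prod, lintegral_prod _ hg.aemeasurable]
  refine lintegral_congr fun x => ?_
  rw [Measure.volume_eq_prod, lintegral_prod _ (by fun_prop)]

lemma lintegral_flowX1 (a : ℝ) {g : ℝ × ℝ × ℝ → ENNReal} (hg : Measurable g) :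
    ∫⁻ w, g (flowX1 a w) = ∫⁻ w, g w := by
  have h1 : Measurable (flowX1 a) := by unfold flowX1; fun_prop
  rw [lintegral_triple (g := fun w => g (flowX1 a w)) (hg.comp h1), lintegral_triple hg,
    ← lintegral_add_right_eq_self (fun x => ∫⁻ y, ∫⁻ t, g (x, y, t)) a]
  refine lintegral_congr fun x => lintegral_congr fun y => ?_
  rw [← lintegral_add_right_eq_self (fun t => g (x + a, y, t)) (-(a * y / 2))]
  simp only [flowX1, sub_eq_add_neg]

lemma lintegral_flowX2 (a : ℝ) {g : ℝ × ℝ × ℝ → ENNReal} (hg : Measurable g) :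
    ∫⁻ w, g (flowX2 a w) = ∫⁻ w, g w := by
  have h1 : Measurable (flowX2 a) := by unfold flowX2; fun_prop
  rw [lintegral_triple (g := fun w => g (flowX2 a w)) (hg.comp h1), lintegral_triple hg]
  refine lintegral_congr fun x => ?_
  rw [← lintegral_add_right_eq_self (fun y => ∫⁻ t, g (x, y, t)) a]
  refine lintegral_congr fun y => ?_
  rw [← lintegral_add_right_eq_self (fun t => g (x, y + a, t)) (a * x / 2)]
  simp only [flowX2]

lemma hasDerivAt_comp_flowX1 {f : ℝ × ℝ × ℝ → ℝ} (hf : Differentiable ℝ f) (w : ℝ × ℝ × ℝ)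
    (s : ℝ) : HasDerivAt (fun s => f (flowX1 s w)) (X1 f (flowX1 s w)) s := by
  have h : HasDerivAt (fun s => flowX1 s w) (1, 0, -(w.2.1) / 2) s := by
    unfold flowX1
    refine HasDerivAt.prodMk ?_ (HasDerivAt.prodMk ?_ ?_)
    · simpa using (hasDerivAt_id s).const_add w.1
    · exact hasDerivAt_const _ _
    · simpa [neg_div] using (((hasDerivAt_id s).mul_const w.2.1).div_const 2).const_sub w.2.2
  exact (hf (flowX1 s w)).hasFDerivAt.comp_hasDerivAt s h

lemma hasDerivAt_comp_flowX2 {f : ℝ × ℝ × ℝ → ℝ} (hf : Differentiable ℝ f) (w : ℝ × ℝ × ℝ)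
    (s : ℝ) : HasDerivAt (fun s => f (flowX2 s w)) (X2 f (flowX2 s w)) s := by
  have h : HasDerivAt (fun s => flowX2 s w) (0, 1, w.1 / 2) s := by
    unfold flowX2
    refine HasDerivAt.prodMk ?_ (HasDerivAt.prodMk ?_ ?_)
    · exact hasDerivAt_const _ _
    · simpa using (hasDerivAt_id s).const_add w.2.1
    · simpa using (((hasDerivAt_id s).mul_const w.1).div_const 2).const_add w.2.2
  exact (hf (flowX2 s w)).hasFDerivAt.comp_hasDerivAt s h

lemma continuous_X1 {f : ℝ × ℝ × ℝ → ℝ} (hf : ContDiff ℝ 1 f) : Continuous (X1 f) := by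
  unfold X1
  exact (hf.continuous_fderiv_apply one_ne_zero).comp
    (by fun_prop : Continuous fun w : ℝ × ℝ × ℝ => (w, ((1 : ℝ), (0 : ℝ), -(w.2.1) / 2)))

lemma continuous_X2 {f : ℝ × ℝ × ℝ → ℝ} (hf : ContDiff ℝ 1 f) : Continuous (X2 f) := by
  unfold X2
  exact (hf.continuous_fderiv_apply one_ne_zero).comp
    (by fun_prop : Continuous fun w : ℝ × ℝ × ℝ => (w, ((0 : ℝ), (1 : ℝ), w.1 / 2)))

lemma gaugeK_flowX1_le {a : ℝ} (ha : |a| ≤ 2) (w : ℝ × ℝ × ℝ) :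
    gaugeK (flowX1 a w) ≤ 145 * gaugeK w := by
  obtain ⟨x, y, t⟩ := w
  simp only [gaugeK, flowX1]
  have ha2 : a ^ 2 ≤ 4 := by nlinarith [abs_le.mp ha]
  have hs : (x + a) ^ 2 + y ^ 2 ≤ 2 * (x ^ 2 + y ^ 2) + 8 := by nlinarith [sq_nonneg (x - a)]
  have hs2 : ((x + a) ^ 2 + y ^ 2) ^ 2 ≤ (2 * (x ^ 2 + y ^ 2) + 8) ^ 2 :=
    pow_le_pow_left₀ (by positivity) hs 2
  have ht : (t - a * y / 2) ^ 2 ≤ 2 * t ^ 2 + 2 * y ^ 2 := by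
    nlinarith [sq_nonneg (t + a * y / 2), mul_nonneg (sub_nonneg.2 ha2) (sq_nonneg y)]
  nlinarith [sq_nonneg (x ^ 2 + y ^ 2 - 1), sq_nonneg x, sq_nonneg y, sq_nonneg t]

lemma gaugeK_flowX2_le {a : ℝ} (ha : |a| ≤ 2) (w : ℝ × ℝ × ℝ) :
    gaugeK (flowX2 a w) ≤ 145 * gaugeK w := by
  obtain ⟨x, y, t⟩ := w
  have h := gaugeK_flowX1_le (a := a) ha (y, x, -t)
  simp only [gaugeK, flowX1, flowX2] at h ⊢
  nlinarith [h]

lemma ofReal_abs_sub_rpow_le {φ φ' : ℝ → ℝ} {q : ℝ} (hq : 1 ≤ q)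
    (h : ∀ s, HasDerivAt φ (φ' s) s) (hc : Continuous φ') :
    ENNReal.ofReal (|φ 1 - φ 0| ^ q) ≤ ∫⁻ s in Ioc (0 : ℝ) 1, ENNReal.ofReal (|φ' s| ^ q) := by
  have hq0 : 0 ≤ q := by linarith
  have hprob : IsProbabilityMeasure (volume.restrict (Ioc (0 : ℝ) 1)) := ⟨by simp⟩
  have hca : Continuous fun s => |φ' s| := hc.abs
  have hcq : Continuous fun s => |φ' s| ^ q := hca.rpow_const fun _ => Or.inr hq0
  have i1 : Integrable (fun s => |φ' s|) (volume.restrict (Ioc (0 : ℝ) 1)) :=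
    (hca.integrableOn_Icc).mono_set Ioc_subset_Icc_self
  have i2 : Integrable (fun s => |φ' s| ^ q) (volume.restrict (Ioc (0 : ℝ) 1)) :=
    (hcq.integrableOn_Icc).mono_set Ioc_subset_Icc_self
  rw [← ofReal_integral_eq_lintegral_ofReal i2 (ae_of_all _ fun s => by positivity)]
  refine ENNReal.ofReal_le_ofReal ?_
  have hj : (∫ s in Ioc (0 : ℝ) 1, |φ' s|) ^ q ≤ ∫ s in Ioc (0 : ℝ) 1, |φ' s| ^ q :=
    (convexOn_rpow hq).map_integral_le (continuousOn_id.rpow_const fun _ _ => Or.inr hq0)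
      isClosed_Ici (ae_of_all _ fun s => mem_Ici.2 (abs_nonneg _)) i1 i2
  refine le_trans (Real.rpow_le_rpow (abs_nonneg _) ?_ hq0) hj
  rw [← intervalIntegral.integral_eq_sub_of_hasDerivAt (fun s _ => h s)
    (hc.intervalIntegrable 0 1), intervalIntegral.integral_of_le zero_le_one]
  exact abs_integral_le_integral_abs

lemma lintegral_restrict_comp_le {Ψ : ℝ × ℝ × ℝ → ℝ × ℝ × ℝ}
    (hinv : ∀ g : ℝ × ℝ × ℝ → ENNReal, Measurable g → ∫⁻ w, g (Ψ w) = ∫⁻ w, g w)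
    {S S' : Set (ℝ × ℝ × ℝ)} (hS : MeasurableSet S) (hS' : MeasurableSet S')
    (hmap : ∀ w ∈ S, Ψ w ∈ S') {g : ℝ × ℝ × ℝ → ENNReal} (hg : Measurable g) :
    ∫⁻ w in S, g (Ψ w) ≤ ∫⁻ w in S', g w := by
  rw [← lintegral_indicator hS, ← lintegral_indicator hS', ← hinv _ (hg.indicator hS')]
  refine lintegral_mono fun w => ?_
  by_cases hw : w ∈ S
  · simp [hw, hmap w hw]
  · simp [hw]

/-- Moving a function along a measure preserving flow costs at most the derivative. -/
lemma lintegral_flow_sub_rpow_le {Φ : ℝ → ℝ × ℝ × ℝ → ℝ × ℝ × ℝ}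
    (hΦ : Continuous (Function.uncurry Φ)) (hΦ0 : ∀ w, Φ 0 w = w)
    (hinv : ∀ a, ∀ g : ℝ × ℝ × ℝ → ENNReal, Measurable g → ∫⁻ w, g (Φ a w) = ∫⁻ w, g w)
    {f D : ℝ × ℝ × ℝ → ℝ} (hD : Continuous D)
    (hder : ∀ w s, HasDerivAt (fun s => f (Φ s w)) (D (Φ s w)) s)
    {S S' : Set (ℝ × ℝ × ℝ)} (hS : MeasurableSet S) (hS' : MeasurableSet S') {a q : ℝ}
    (hq : 1 ≤ q) (hmap : ∀ s ∈ Ioc (0 : ℝ) 1, ∀ w ∈ S, Φ (s * a) w ∈ S') :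
    ∫⁻ w in S, ENNReal.ofReal (|f (Φ a w) - f w| ^ q) ≤
      ENNReal.ofReal (|a| ^ q) * ∫⁻ w in S', ENNReal.ofReal (|D w| ^ q) := by
  have hq0 : 0 ≤ q := by linarith
  have hDq : Continuous fun w => ENNReal.ofReal (|D w| ^ q) :=
    ENNReal.continuous_ofReal.comp (hD.abs.rpow_const fun _ => Or.inr hq0)
  have hpt : ∀ w, ENNReal.ofReal (|f (Φ a w) - f w| ^ q) ≤
      ∫⁻ s in Ioc (0 : ℝ) 1,
        ENNReal.ofReal (|a| ^ q) * ENNReal.ofReal (|D (Φ (s * a) w)| ^ q) := by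
    intro w
    have h1 : ∀ s : ℝ, HasDerivAt (fun s => f (Φ (s * a) w)) (D (Φ (s * a) w) * a) s := by
      intro s
      exact (hder w (s * a)).comp s (by simpa using (hasDerivAt_id s).mul_const a)
    have hc : Continuous fun s : ℝ => D (Φ (s * a) w) * a :=
      (hD.comp (hΦ.comp (by fun_prop : Continuous fun s : ℝ => (s * a, w)))).mul
        continuous_const
    have h2 := ofReal_abs_sub_rpow_le hq h1 hc
    simp only [one_mul, zero_mul, hΦ0] at h2
    refine h2.trans_eq (lintegral_congr fun s => ?_)
    rw [abs_mul, Real.mul_rpow (abs_nonneg _) (abs_nonneg _), mul_comm,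
      ENNReal.ofReal_mul (by positivity)]
  have hmeas : Measurable fun z : ℝ × (ℝ × ℝ × ℝ) =>
      ENNReal.ofReal (|a| ^ q) * ENNReal.ofReal (|D (Φ (z.1 * a) z.2)| ^ q) :=
    ((hDq.comp (hΦ.comp (by fun_prop : Continuous fun z : ℝ × (ℝ × ℝ × ℝ) =>
      (z.1 * a, z.2)))).measurable).const_mul _
  calc ∫⁻ w in S, ENNReal.ofReal (|f (Φ a w) - f w| ^ q)
      ≤ ∫⁻ w in S, ∫⁻ s in Ioc (0 : ℝ) 1,
        ENNReal.ofReal (|a| ^ q) * ENNReal.ofReal (|D (Φ (s * a) w)| ^ q) :=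
          lintegral_mono hpt
    _ = ∫⁻ s in Ioc (0 : ℝ) 1, ∫⁻ w in S,
        ENNReal.ofReal (|a| ^ q) * ENNReal.ofReal (|D (Φ (s * a) w)| ^ q) :=
          lintegral_lintegral_swap (hmeas.comp measurable_swap).aemeasurable
    _ ≤ ∫⁻ s in Ioc (0 : ℝ) 1,
        ENNReal.ofReal (|a| ^ q) * ∫⁻ w in S', ENNReal.ofReal (|D w| ^ q) := by
          refine setLIntegral_mono' measurableSet_Ioc fun s hs => ?_
          rw [lintegral_const_mul' _ _ ENNReal.ofReal_ne_top]
          refine mul_le_mul' le_rfl ?_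
          exact lintegral_restrict_comp_le (g := fun w => ENNReal.ofReal (|D w| ^ q)) (hinv _) hS
            hS' (hmap s hs) hDq.measurable
    _ = _ := by simp

/-- The end point of the path following `X1`, `X2`, `X1` for times `a`, `b`, `c`. -/
noncomputable def threeStep (a b c : ℝ) (w : ℝ × ℝ × ℝ) : ℝ × ℝ × ℝ :=
  flowX1 c (flowX2 b (flowX1 a w))

lemma lintegral_comp_const_add_mul {g : ℝ → ENNReal} (hg : Measurable g) (k : ℝ) {b : ℝ}
    (hb : 0 < b) : ∫⁻ a, g (k + a * b) = ENNReal.ofReal b⁻¹ * ∫⁻ t, g t := by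
  have h1 := lintegral_map (μ := volume) (f := fun x => g (k + x))
    (hg.comp (measurable_const_add k)) (measurable_const_mul b)
  rw [Real.map_volume_mul_left hb.ne', lintegral_smul_measure, abs_of_pos (inv_pos.2 hb),
    lintegral_add_left_eq_self] at h1
  rw [← smul_eq_mul, h1]
  simp only [mul_comm]

lemma lintegral_threeStep_le {g : ℝ × ℝ × ℝ → ENNReal} (hg : Measurable g) {δ : ℝ} (hδ : 0 < δ)
    (w : ℝ × ℝ × ℝ) :
    ∫⁻ b in Icc δ (2 * δ), ∫⁻ a in Icc 0 δ, ∫⁻ c in Icc 0 δ, g (threeStep a b c w) ≤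
      ENNReal.ofReal δ⁻¹ * ∫⁻ v, g v := by
  obtain ⟨x, y, t⟩ := w
  have key : ∀ b, 0 < b → ∫⁻ a, ∫⁻ c, g (threeStep a b c (x, y, t)) =
      ENNReal.ofReal b⁻¹ * ∫⁻ c, ∫⁻ s, g (x + c, y + b, s) := by
    intro b hb
    have e1 : ∀ a, ∫⁻ c, g (threeStep a b c (x, y, t)) =
        ∫⁻ c, g (x + c, y + b, (t + b * x / 2 - c * (y + b) / 2) + a * b) := by
      intro a
      rw [← lintegral_add_right_eq_self
        (fun c => g (x + c, y + b, (t + b * x / 2 - c * (y + b) / 2) + a * b)) a]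
      refine lintegral_congr fun c => ?_
      congr 1
      simp only [threeStep, flowX1, flowX2, Prod.mk.injEq, true_and]
      constructor <;> ring
    simp_rw [e1]
    rw [lintegral_lintegral_swap, ← lintegral_const_mul']
    · refine lintegral_congr fun c => ?_
      exact lintegral_comp_const_add_mul (g := fun s => g (x + c, y + b, s)) (by fun_prop) _ hb
    · exact ENNReal.ofReal_ne_top
    · exact (hg.comp (by fun_prop : Measurable fun z : ℝ × ℝ =>
        (x + z.2, y + b, (t + b * x / 2 - z.2 * (y + b) / 2) + z.1 * b))).aemeasurable
  have hm : Measurable fun z : ℝ × ℝ => ∫⁻ s, g (x + z.2, y + z.1, s) := by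
    refine Measurable.lintegral_prod_right'
      (f := fun p : (ℝ × ℝ) × ℝ => g (x + p.1.2, y + p.1.1, p.2)) ?_
    exact hg.comp (by fun_prop)
  calc _ ≤ ∫⁻ b in Icc δ (2 * δ), ENNReal.ofReal δ⁻¹ * ∫⁻ c, ∫⁻ s, g (x + c, y + b, s) := by
        refine setLIntegral_mono' measurableSet_Icc fun b hb => ?_
        have hb0 : 0 < b := hδ.trans_le hb.1
        calc _ ≤ ∫⁻ a, ∫⁻ c, g (threeStep a b c (x, y, t)) :=
              (setLIntegral_le_lintegral _ _).trans
                (lintegral_mono fun a => setLIntegral_le_lintegral _ _)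
          _ = _ := key b hb0
          _ ≤ _ := by gcongr; exact hb.1
    _ ≤ ENNReal.ofReal δ⁻¹ * ∫⁻ b, ∫⁻ c, ∫⁻ s, g (x + c, y + b, s) := by
        rw [lintegral_const_mul' _ _ ENNReal.ofReal_ne_top]
        exact mul_le_mul' le_rfl (setLIntegral_le_lintegral _ _)
    _ = _ := by
        rw [lintegral_lintegral_swap hm.aemeasurable, lintegral_triple hg,
          ← lintegral_add_left_eq_self (fun x => ∫⁻ y, ∫⁻ t, g (x, y, t)) x]
        congr 1
        refine lintegral_congr fun c => ?_
        rw [← lintegral_add_left_eq_self (fun y => ∫⁻ t, g (x + c, y, t)) y]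

lemma isClosed_gaugeK_le (κ : ℝ) : IsClosed {w | gaugeK w ≤ κ} :=
  isClosed_le (by unfold gaugeK; fun_prop) continuous_const

lemma add_add_rpow_le {x y z q : ℝ} (hx : 0 ≤ x) (hy : 0 ≤ y) (hz : 0 ≤ z) (hq0 : 0 ≤ q)
    (hq : q ≤ 2) : (x + y + z) ^ q ≤ 9 * (x ^ q + y ^ q + z ^ q) := by
  have h9 : (3 : ℝ) ^ q ≤ 9 := by
    calc (3 : ℝ) ^ q ≤ 3 ^ (2 : ℝ) := Real.rpow_le_rpow_of_exponent_le (by norm_num) hq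
      _ = 9 := by norm_num
  have key : ∀ m, 0 ≤ m → x + y + z ≤ 3 * m → (x + y + z) ^ q ≤ 9 * m ^ q := by
    intro m hm h
    calc (x + y + z) ^ q ≤ (3 * m) ^ q := Real.rpow_le_rpow (by positivity) h hq0
      _ = 3 ^ q * m ^ q := Real.mul_rpow (by norm_num) hm
      _ ≤ _ := by gcongr
  have := Real.rpow_nonneg hx q
  have := Real.rpow_nonneg hy q
  have := Real.rpow_nonneg hz q
  rcases le_total x y with h1 | h1 <;> rcases le_total y z with h2 | h2 <;>
    rcases le_total x z with h3 | h3
  all_goals first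
    | linarith [key x hx (by linarith)]
    | linarith [key y hy (by linarith)]
    | linarith [key z hz (by linarith)]

lemma abs_X1_rpow_le (f : ℝ × ℝ × ℝ → ℝ) (w : ℝ × ℝ × ℝ) {q : ℝ} (hq : 0 ≤ q) :
    |X1 f w| ^ q ≤ (X1 f w ^ 2 + X2 f w ^ 2) ^ (q / 2) := by
  have : |X1 f w| ^ q = (X1 f w ^ 2) ^ (q / 2) := by
    rw [← sq_abs, ← Real.rpow_natCast, ← Real.rpow_mul (abs_nonneg _)]; congr 1; push_cast; ring
  rw [this]
  exact Real.rpow_le_rpow (by positivity) (by nlinarith [sq_nonneg (X2 f w)]) (by positivity)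

lemma abs_X2_rpow_le (f : ℝ × ℝ × ℝ → ℝ) (w : ℝ × ℝ × ℝ) {q : ℝ} (hq : 0 ≤ q) :
    |X2 f w| ^ q ≤ (X1 f w ^ 2 + X2 f w ^ 2) ^ (q / 2) := by
  have : |X2 f w| ^ q = (X2 f w ^ 2) ^ (q / 2) := by
    rw [← sq_abs, ← Real.rpow_natCast, ← Real.rpow_mul (abs_nonneg _)]; congr 1; push_cast; ring
  rw [this]
  exact Real.rpow_le_rpow (by positivity) (by nlinarith [sq_nonneg (X1 f w)]) (by positivity)

lemma lintegral_threeStep_sub_rpow_le {f : ℝ × ℝ × ℝ → ℝ} (hf : ContDiff ℝ 1 f) {q : ℝ}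
    (hq1 : 1 ≤ q) (hq2 : q ≤ 2) {κ r : ℝ} (hr : r ≤ 2) {a b c : ℝ}
    (ha : a ∈ Icc 0 r) (hb : b ∈ Icc 0 r) (hc : c ∈ Icc 0 r) :
    ∫⁻ w in {w | gaugeK w ≤ κ}, ENNReal.ofReal (|f (threeStep a b c w) - f w| ^ q) ≤
      ENNReal.ofReal (27 * r ^ q) * ∫⁻ w in {w | gaugeK w ≤ 145 ^ 3 * κ},
        ENNReal.ofReal ((X1 f w ^ 2 + X2 f w ^ 2) ^ (q / 2)) := by
  have hq0 : 0 ≤ q := by linarith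
  have hr0 : 0 ≤ r := ha.1.trans ha.2
  set G := ∫⁻ w in {w | gaugeK w ≤ 145 ^ 3 * κ},
        ENNReal.ofReal ((X1 f w ^ 2 + X2 f w ^ 2) ^ (q / 2)) with hG
  have hfd : Differentiable ℝ f := hf.differentiable one_ne_zero
  have hms : ∀ κ, MeasurableSet {w | gaugeK w ≤ κ} := fun κ => (isClosed_gaugeK_le κ).measurableSet
  have habs : ∀ s ∈ Ioc (0 : ℝ) 1, ∀ a ∈ Icc 0 r, |s * a| ≤ 2 := by
    intro s hs a ha
    rw [abs_of_nonneg (mul_nonneg hs.1.le ha.1)]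
    nlinarith [hs.1, hs.2, ha.1, ha.2]
  have hm1 : ∀ κ, ∀ a ∈ Icc 0 r, ∀ s ∈ Ioc (0 : ℝ) 1, ∀ w ∈ {w | gaugeK w ≤ κ},
      flowX1 (s * a) w ∈ {w | gaugeK w ≤ 145 * κ} := by
    intro κ a ha s hs w hw
    have := gaugeK_flowX1_le (habs s hs a ha) w
    simp only [mem_ofPred_eq] at hw ⊢; linarith
  have hm2 : ∀ κ, ∀ a ∈ Icc 0 r, ∀ s ∈ Ioc (0 : ℝ) 1, ∀ w ∈ {w | gaugeK w ≤ κ},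
      flowX2 (s * a) w ∈ {w | gaugeK w ≤ 145 * κ} := by
    intro κ a ha s hs w hw
    have := gaugeK_flowX2_le (habs s hs a ha) w
    simp only [mem_ofPred_eq] at hw ⊢; linarith
  have hone : (1 : ℝ) ∈ Ioc (0 : ℝ) 1 := by simp
  have hstepX1 : ∀ κ' ≤ 145 ^ 2 * κ, ∀ a ∈ Icc 0 r, ∫⁻ w in {w | gaugeK w ≤ κ'},
      ENNReal.ofReal (|f (flowX1 a w) - f w| ^ q) ≤ ENNReal.ofReal (r ^ q) * G := by
    intro κ' hκ' a ha
    refine (lintegral_flow_sub_rpow_le continuous_flowX1 (by simp [flowX1])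
      (fun a g hg => lintegral_flowX1 a hg) (continuous_X1 hf)
      (hasDerivAt_comp_flowX1 hfd) (hms _) (hms _) hq1 (hm1 κ' a ha)).trans ?_
    rw [abs_of_nonneg ha.1]
    refine mul_le_mul' (ENNReal.ofReal_le_ofReal (Real.rpow_le_rpow ha.1 ha.2 hq0)) ?_
    refine (lintegral_mono fun w => ENNReal.ofReal_le_ofReal (abs_X1_rpow_le f w hq0)).trans ?_
    exact lintegral_mono_set fun w hw => by simp only [mem_ofPred_eq] at hw ⊢; linarith
  have hstepX2 : ∀ κ' ≤ 145 ^ 2 * κ, ∀ a ∈ Icc 0 r, ∫⁻ w in {w | gaugeK w ≤ κ'},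
      ENNReal.ofReal (|f (flowX2 a w) - f w| ^ q) ≤ ENNReal.ofReal (r ^ q) * G := by
    intro κ' hκ' a ha
    refine (lintegral_flow_sub_rpow_le continuous_flowX2 (by simp [flowX2])
      (fun a g hg => lintegral_flowX2 a hg) (continuous_X2 hf)
      (hasDerivAt_comp_flowX2 hfd) (hms _) (hms _) hq1 (hm2 κ' a ha)).trans ?_
    rw [abs_of_nonneg ha.1]
    refine mul_le_mul' (ENNReal.ofReal_le_ofReal (Real.rpow_le_rpow ha.1 ha.2 hq0)) ?_
    refine (lintegral_mono fun w => ENNReal.ofReal_le_ofReal (abs_X2_rpow_le f w hq0)).trans ?_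
    exact lintegral_mono_set fun w hw => by simp only [mem_ofPred_eq] at hw ⊢; linarith
  have c1 : ∀ a, Continuous (flowX1 a) := fun a => by unfold flowX1; fun_prop
  have c2 : ∀ a, Continuous (flowX2 a) := fun a => by unfold flowX2; fun_prop
  have cq : ∀ Ψ : ℝ × ℝ × ℝ → ℝ × ℝ × ℝ, Continuous Ψ →
      Measurable fun w => ENNReal.ofReal (|f (Ψ w) - f w| ^ q) := fun Ψ hΨ =>
    (ENNReal.continuous_ofReal.comp (((hf.continuous.comp hΨ).sub hf.continuous).abs.rpow_const
      fun _ => Or.inr hq0)).measurable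
  rcases lt_or_ge κ 1 with hκ | hκ
  · have : {w | gaugeK w ≤ κ} = ∅ := by
      ext w
      simp only [mem_ofPred_eq, mem_empty_iff_false, iff_false, not_le]
      linarith [one_le_gaugeK w]
    simp [this]
  have sA := hstepX1 κ (by nlinarith) a ha
  have sB : ∫⁻ w in {w | gaugeK w ≤ κ},
      ENNReal.ofReal (|f (flowX2 b (flowX1 a w)) - f (flowX1 a w)| ^ q) ≤
      ENNReal.ofReal (r ^ q) * G :=
    (lintegral_restrict_comp_le (fun g hg => lintegral_flowX1 a hg)
      (hms κ) (hms (145 * κ)) (fun w hw => by simpa using hm1 κ a ha 1 hone w hw)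
      (cq _ (c2 b))).trans (hstepX2 _ (by nlinarith) b hb)
  have sC : ∫⁻ w in {w | gaugeK w ≤ κ},
      ENNReal.ofReal (|f (flowX1 c (flowX2 b (flowX1 a w))) - f (flowX2 b (flowX1 a w))| ^ q) ≤
      ENNReal.ofReal (r ^ q) * G :=
    ((lintegral_restrict_comp_le (fun g hg => lintegral_flowX1 a hg)
      (hms κ) (hms (145 * κ)) (fun w hw => by simpa using hm1 κ a ha 1 hone w hw)
      ((cq _ (c1 c)).comp (c2 b).measurable)).trans
    (lintegral_restrict_comp_le (fun g hg => lintegral_flowX2 b hg)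
      (hms (145 * κ)) (hms (145 * (145 * κ)))
      (fun w hw => by simpa using hm2 (145 * κ) b hb 1 hone w hw)
      (cq _ (c1 c)))).trans (hstepX1 _ (by nlinarith) c hc)
  have hpt : ∀ w, ENNReal.ofReal (|f (threeStep a b c w) - f w| ^ q) ≤
      ENNReal.ofReal 9 * (ENNReal.ofReal (|f (flowX1 a w) - f w| ^ q) +
        ENNReal.ofReal (|f (flowX2 b (flowX1 a w)) - f (flowX1 a w)| ^ q) +
        ENNReal.ofReal
          (|f (flowX1 c (flowX2 b (flowX1 a w))) - f (flowX2 b (flowX1 a w))| ^ q)) := by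
    intro w
    rw [← ENNReal.ofReal_add (by positivity) (by positivity),
      ← ENNReal.ofReal_add (by positivity) (by positivity), ← ENNReal.ofReal_mul (by norm_num)]
    refine ENNReal.ofReal_le_ofReal (le_trans (Real.rpow_le_rpow (abs_nonneg _) ?_ hq0)
      (add_add_rpow_le (abs_nonneg _) (abs_nonneg _) (abs_nonneg _) hq0 hq2))
    have e : f (threeStep a b c w) - f w = (f (flowX1 a w) - f w) +
      (f (flowX2 b (flowX1 a w)) - f (flowX1 a w)) +
      (f (flowX1 c (flowX2 b (flowX1 a w))) - f (flowX2 b (flowX1 a w))) := by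
      simp only [threeStep]; ring
    rw [e]
    exact (abs_add_le _ _).trans (add_le_add_left (abs_add_le _ _) _)
  calc _ ≤ _ := lintegral_mono hpt
    _ ≤ ENNReal.ofReal 9 * (ENNReal.ofReal (r ^ q) * G + ENNReal.ofReal (r ^ q) * G +
        ENNReal.ofReal (r ^ q) * G) := by
      rw [lintegral_const_mul' _ _ ENNReal.ofReal_ne_top, lintegral_add_left,
        lintegral_add_left]
      · gcongr
      · exact cq _ (c1 a)
      · exact (cq _ (c1 a)).add ((cq _ (c2 b)).comp (c1 a).measurable)
    _ = _ := by
      rw [ENNReal.ofReal_mul (by norm_num : (0 : ℝ) ≤ 27)]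
      norm_num
      ring

lemma rpow_le_mul_add_rpow_sub {x y q : ℝ} (hq0 : 0 < q) (hq2 : q ≤ 2) :
    |x| ^ q ≤ 2 * (|x| ^ (q / 2) * |y| ^ (q / 2)) + |y - x| ^ q := by
  have e : ∀ u : ℝ, |u| ^ q = (|u| ^ (q / 2)) ^ 2 := fun u => by
    rw [← Real.rpow_natCast, ← Real.rpow_mul (abs_nonneg _)]; congr 1; push_cast; ring
  have h : |x| ^ (q / 2) ≤ |y| ^ (q / 2) + |y - x| ^ (q / 2) := by
    refine le_trans (Real.rpow_le_rpow (abs_nonneg _) ?_ (by positivity))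
      (Real.rpow_add_le_add_rpow (abs_nonneg _) (abs_nonneg _) (by positivity) (by linarith))
    have := abs_sub_abs_le_abs_sub x y
    rw [abs_sub_comm] at this; linarith
  have hx : 0 ≤ |x| ^ (q / 2) := by positivity
  rw [e x, e (y - x)]
  nlinarith [sq_nonneg (|x| ^ (q / 2) - |y - x| ^ (q / 2))]

/-- Local super-Poincaré inequality for Lebesgue measure on gauge balls. -/
lemma lintegral_rpow_le_local {f : ℝ × ℝ × ℝ → ℝ} (hf : ContDiff ℝ 1 f) {q : ℝ}
    (hq1 : 1 ≤ q) (hq2 : q ≤ 2) {κ δ : ℝ} (hδ0 : 0 < δ) (hδ1 : δ ≤ 1) :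
    ∫⁻ w in {w | gaugeK w ≤ κ}, ENNReal.ofReal (|f w| ^ q) ≤
      ENNReal.ofReal (2 * δ⁻¹ ^ 4) * ((∫⁻ w in {w | gaugeK w ≤ 145 ^ 3 * κ},
        ENNReal.ofReal (|f w| ^ (q / 2))) * (∫⁻ w in {w | gaugeK w ≤ 145 ^ 3 * κ},
        ENNReal.ofReal (|f w| ^ (q / 2)))) +
      ENNReal.ofReal (27 * (2 * δ) ^ q) * ∫⁻ w in {w | gaugeK w ≤ 145 ^ 3 * κ},
        ENNReal.ofReal ((X1 f w ^ 2 + X2 f w ^ 2) ^ (q / 2)) := by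
  have hq0 : 0 < q := by linarith
  set S := {w | gaugeK w ≤ κ} with hSdef
  set S' := {w | gaugeK w ≤ 145 ^ 3 * κ} with hS'def
  have hS : MeasurableSet S := (isClosed_gaugeK_le _).measurableSet
  have hS' : MeasurableSet S' := (isClosed_gaugeK_le _).measurableSet
  set G := ∫⁻ w in S', ENNReal.ofReal ((X1 f w ^ 2 + X2 f w ^ 2) ^ (q / 2))
  set h : ℝ × ℝ × ℝ → ENNReal := fun w => ENNReal.ofReal (|f w| ^ (q / 2)) with hh
  have hSS' : S ⊆ S' := fun w hw => by
    have h0 := one_le_gaugeK w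
    simp only [hSdef, hS'def, mem_ofPred_eq] at hw ⊢; linarith
  have hhm : Measurable h := (ENNReal.continuous_ofReal.comp
    (hf.continuous.abs.rpow_const fun _ => Or.inr (by positivity))).measurable
  set g : ℝ × ℝ × ℝ → ENNReal := S'.indicator h with hg
  have hgm : Measurable g := hhm.indicator hS'
  set B : Measure (ℝ × ℝ × ℝ) := (volume.restrict (Icc δ (2 * δ))).prod
    ((volume.restrict (Icc 0 δ)).prod (volume.restrict (Icc 0 δ))) with hB
  have hBae : ∀ᵐ z ∂B, z ∈ Icc δ (2 * δ) ×ˢ (Icc 0 δ ×ˢ Icc 0 δ) := by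
    rw [hB, Measure.prod_restrict, Measure.prod_restrict]
    exact ae_restrict_mem (measurableSet_Icc.prod (measurableSet_Icc.prod measurableSet_Icc))
  have hBvol : B univ = ENNReal.ofReal (δ ^ 3) := by
    rw [hB, ← univ_prod_univ, Measure.prod_prod, ← univ_prod_univ, Measure.prod_prod]
    simp only [Measure.restrict_apply_univ, Real.volume_Icc]
    rw [← ENNReal.ofReal_mul (by linarith), ← ENNReal.ofReal_mul (by linarith)]
    congr 1; ring
  have hδ2 : 2 * δ ≤ 2 := by linarith
  have hγ : Continuous fun z : (ℝ × ℝ × ℝ) × (ℝ × ℝ × ℝ) =>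
      threeStep z.1.2.1 z.1.1 z.1.2.2 z.2 := by
    unfold threeStep flowX1 flowX2; fun_prop
  have hpath : ∀ z ∈ Icc δ (2 * δ) ×ˢ (Icc (0 : ℝ) δ ×ˢ Icc (0 : ℝ) δ),
      ∫⁻ w in S, ENNReal.ofReal (|f w| ^ q) ≤
        (∫⁻ w in S, 2 * (h w * g (threeStep z.2.1 z.1 z.2.2 w))) +
          ENNReal.ofReal (27 * (2 * δ) ^ q) * G := by
    rintro ⟨b, a, c⟩ ⟨hb, ha, hc⟩
    simp only at hb ha hc
    have hb' : b ∈ Icc 0 (2 * δ) := ⟨hδ0.le.trans hb.1, hb.2⟩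
    have ha' : a ∈ Icc 0 (2 * δ) := ⟨ha.1, ha.2.trans (by linarith)⟩
    have hc' : c ∈ Icc 0 (2 * δ) := ⟨hc.1, hc.2.trans (by linarith)⟩
    have habs : ∀ a ∈ Icc 0 (2 * δ), |a| ≤ 2 := fun a ha => by
      rw [abs_of_nonneg ha.1]; linarith [ha.2]
    refine le_trans ?_ (add_le_add_right
      (lintegral_threeStep_sub_rpow_le hf hq1 hq2 (κ := κ) hδ2 ha' hb' hc') _)
    rw [← lintegral_add_left]
    · refine setLIntegral_mono' hS fun w hw => ?_
      have hin : threeStep a b c w ∈ S' := by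
        have h1 := gaugeK_flowX1_le (habs a ha') w
        have h2 := gaugeK_flowX2_le (habs b hb') (flowX1 a w)
        have h3 := gaugeK_flowX1_le (habs c hc') (flowX2 b (flowX1 a w))
        simp only [hSdef, hS'def, threeStep, mem_ofPred_eq] at hw ⊢
        linarith
      simp only [hg, indicator_of_mem hin, hh]
      rw [← ENNReal.ofReal_mul (by positivity), ← ENNReal.ofReal_ofNat 2,
        ← ENNReal.ofReal_mul (by norm_num), ← ENNReal.ofReal_add (by positivity) (by positivity)]
      exact ENNReal.ofReal_le_ofReal (rpow_le_mul_add_rpow_sub hq0 hq2)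
    · exact (hhm.mul (hgm.comp (hγ.comp (by fun_prop : Continuous fun w : ℝ × ℝ × ℝ =>
        ((b, a, c), w))).measurable)).const_mul _
  have hmeas2 : Measurable fun z : (ℝ × ℝ × ℝ) × (ℝ × ℝ × ℝ) =>
      2 * (h z.2 * g (threeStep z.1.2.1 z.1.1 z.1.2.2 z.2)) :=
    ((hhm.comp measurable_snd).mul (hgm.comp hγ.measurable)).const_mul _
  have hbox : ∫⁻ z : ℝ × ℝ × ℝ, (∫⁻ w in S, 2 * (h w * g (threeStep z.2.1 z.1 z.2.2 w))) ∂B ≤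
      ENNReal.ofReal (2 * δ⁻¹) * ((∫⁻ w in S', h w) * ∫⁻ w in S', h w) := by
    rw [lintegral_lintegral_swap hmeas2.aemeasurable]
    have inner : ∀ w, ∫⁻ z, 2 * (h w * g (threeStep z.2.1 z.1 z.2.2 w)) ∂B ≤
        h w * (ENNReal.ofReal (2 * δ⁻¹) * ∫⁻ w in S', h w) := by
      intro w
      have hgw : Measurable fun z : ℝ × ℝ × ℝ => g (threeStep z.2.1 z.1 z.2.2 w) :=
        hgm.comp (hγ.comp (by fun_prop : Continuous fun z : ℝ × ℝ × ℝ => (z, w))).measurable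
      have k := lintegral_threeStep_le hgm hδ0 w
      rw [hg, lintegral_indicator hS', ← hg] at k
      have e : ∫⁻ z, g (threeStep z.2.1 z.1 z.2.2 w) ∂B = ∫⁻ b in Icc δ (2 * δ),
          ∫⁻ a in Icc 0 δ, ∫⁻ c in Icc 0 δ, g (threeStep a b c w) := by
        rw [hB, lintegral_prod _ hgw.aemeasurable]
        refine lintegral_congr fun b => ?_
        rw [lintegral_prod]
        exact (hgw.comp measurable_prodMk_left).aemeasurable
      rw [lintegral_const_mul _ (hgw.const_mul _), lintegral_const_mul _ hgw, e,
        ENNReal.ofReal_mul (by norm_num), ENNReal.ofReal_ofNat]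
      calc _ ≤ 2 * (h w * (ENNReal.ofReal δ⁻¹ * ∫⁻ w in S', h w)) := by gcongr
        _ = _ := by ring
    refine (lintegral_mono inner).trans ?_
    rw [lintegral_mul_const _ hhm]
    calc _ ≤ (∫⁻ w in S', h w) * (ENNReal.ofReal (2 * δ⁻¹) * ∫⁻ w in S', h w) := by
          gcongr
      _ = _ := by ring
  have hmain : (∫⁻ w in S, ENNReal.ofReal (|f w| ^ q)) * ENNReal.ofReal (δ ^ 3) ≤
      ENNReal.ofReal (2 * δ⁻¹) * ((∫⁻ w in S', h w) * ∫⁻ w in S', h w) +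
        ENNReal.ofReal (27 * (2 * δ) ^ q) * G * ENNReal.ofReal (δ ^ 3) := by
    rw [← hBvol]
    calc _ = ∫⁻ _, (∫⁻ w in S, ENNReal.ofReal (|f w| ^ q)) ∂B := by rw [lintegral_const]
      _ ≤ ∫⁻ z, ((∫⁻ w in S, 2 * (h w * g (threeStep z.2.1 z.1 z.2.2 w))) +
          ENNReal.ofReal (27 * (2 * δ) ^ q) * G) ∂B :=
            lintegral_mono_ae (hBae.mono hpath)
      _ ≤ _ := by
        rw [lintegral_add_right _ measurable_const, lintegral_const]
        gcongr
  have h1 : ENNReal.ofReal (δ ^ 3) * ENNReal.ofReal (δ⁻¹ ^ 3) = 1 := by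
    rw [← ENNReal.ofReal_mul (by positivity), ← mul_pow, mul_inv_cancel₀ hδ0.ne']; simp
  calc _ = (∫⁻ w in S, ENNReal.ofReal (|f w| ^ q)) * ENNReal.ofReal (δ ^ 3) *
        ENNReal.ofReal (δ⁻¹ ^ 3) := by rw [mul_assoc, h1, mul_one]
    _ ≤ (ENNReal.ofReal (2 * δ⁻¹) * ((∫⁻ w in S', h w) * ∫⁻ w in S', h w) +
        ENNReal.ofReal (27 * (2 * δ) ^ q) * G * ENNReal.ofReal (δ ^ 3)) *
        ENNReal.ofReal (δ⁻¹ ^ 3) := by gcongr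
    _ = _ := by
      rw [add_mul, mul_assoc (ENNReal.ofReal (27 * (2 * δ) ^ q) * G), h1, mul_one]
      congr 1
      rw [mul_right_comm, ← ENNReal.ofReal_mul (by positivity)]
      congr 2; ring

lemma X1_eq_of_hasDerivAt {f : ℝ × ℝ × ℝ → ℝ} (hf : Differentiable ℝ f) {w : ℝ × ℝ × ℝ} {d : ℝ}
    (h : HasDerivAt (fun s => f (flowX1 s w)) d 0) : X1 f w = d := by
  have h1 := hasDerivAt_comp_flowX1 hf w 0
  have e : flowX1 0 w = w := by simp [flowX1]
  rw [e] at h1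
  exact h1.unique h

lemma X2_eq_of_hasDerivAt {f : ℝ × ℝ × ℝ → ℝ} (hf : Differentiable ℝ f) {w : ℝ × ℝ × ℝ} {d : ℝ}
    (h : HasDerivAt (fun s => f (flowX2 s w)) d 0) : X2 f w = d := by
  have h1 := hasDerivAt_comp_flowX2 hf w 0
  have e : flowX2 0 w = w := by simp [flowX2]
  rw [e] at h1
  exact h1.unique h

lemma X1_mul {f g : ℝ × ℝ × ℝ → ℝ} (hf : Differentiable ℝ f) (hg : Differentiable ℝ g)
    (w : ℝ × ℝ × ℝ) : X1 (fun w => f w * g w) w = X1 f w * g w + f w * X1 g w := by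
  unfold X1
  rw [fderiv_fun_mul (hf w) (hg w)]
  simp only [add_apply, smul_apply, smul_eq_mul]
  ring

lemma X2_mul {f g : ℝ × ℝ × ℝ → ℝ} (hf : Differentiable ℝ f) (hg : Differentiable ℝ g)
    (w : ℝ × ℝ × ℝ) : X2 (fun w => f w * g w) w = X2 f w * g w + f w * X2 g w := by
  unfold X2
  rw [fderiv_fun_mul (hf w) (hg w)]
  simp only [add_apply, smul_apply, smul_eq_mul]
  ring

lemma X1_comp {f : ℝ × ℝ × ℝ → ℝ} {φ : ℝ → ℝ} (hf : Differentiable ℝ f) {w : ℝ × ℝ × ℝ} {d : ℝ}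
    (hφ : HasDerivAt φ d (f w)) : X1 (fun w => φ (f w)) w = d * X1 f w := by
  unfold X1
  have h : fderiv ℝ (fun w => φ (f w)) w = d • fderiv ℝ f w :=
    (hφ.comp_hasFDerivAt w (hf w).hasFDerivAt).fderiv
  simp [h]

lemma X2_comp {f : ℝ × ℝ × ℝ → ℝ} {φ : ℝ → ℝ} (hf : Differentiable ℝ f) {w : ℝ × ℝ × ℝ} {d : ℝ}
    (hφ : HasDerivAt φ d (f w)) : X2 (fun w => φ (f w)) w = d * X2 f w := by
  unfold X2
  have h : fderiv ℝ (fun w => φ (f w)) w = d • fderiv ℝ f w :=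
    (hφ.comp_hasFDerivAt w (hf w).hasFDerivAt).fderiv
  simp [h]

lemma hasCompactSupport_X1 {f : ℝ × ℝ × ℝ → ℝ} (hf : HasCompactSupport f) :
    HasCompactSupport (X1 f) :=
  (hf.fderiv ℝ).mono' fun w hw => subset_tsupport _ fun h => hw (by simp [X1, h])

lemma hasCompactSupport_X2 {f : ℝ × ℝ × ℝ → ℝ} (hf : HasCompactSupport f) :
    HasCompactSupport (X2 f) :=
  (hf.fderiv ℝ).mono' fun w hw => subset_tsupport _ fun h => hw (by simp [X2, h])

lemma integral_fderiv_apply_eq_zero {P : ℝ × ℝ × ℝ → ℝ} (hP : ContDiff ℝ 1 P)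
    (hc : HasCompactSupport P) (v : ℝ × ℝ × ℝ) :
    Integrable (fun w => fderiv ℝ P w v) ∧ ∫ w, fderiv ℝ P w v = 0 := by
  have hi : Integrable (fun w => fderiv ℝ P w v) :=
    ((hP.continuous_fderiv one_ne_zero).clm_apply continuous_const).integrable_of_hasCompactSupport
      (hc.fderiv_apply ℝ v)
  refine ⟨hi, ?_⟩
  have : (volume : Measure (ℝ × ℝ × ℝ)).IsAddHaarMeasure := inferInstanceAs
    (Measure.IsAddHaarMeasure ((volume : Measure ℝ).prod (volume : Measure (ℝ × ℝ))))
  have h := integral_mul_fderiv_eq_neg_fderiv_mul_of_integrable (μ := volume)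
    (f := fun _ : ℝ × ℝ × ℝ => (1 : ℝ)) (g := P) (v := v) (by simp) (by simpa using hi)
    (by simpa using hP.continuous.integrable_of_hasCompactSupport hc)
    (fun _ _ => differentiableAt_const _) (fun w _ => hP.differentiable one_ne_zero w)
  simpa using h

lemma integral_X1_eq_zero {P : ℝ × ℝ × ℝ → ℝ} (hP : ContDiff ℝ 1 P)
    (hc : HasCompactSupport P) : ∫ w, X1 P w = 0 := by
  have hl : ContDiff ℝ 1 fun w : ℝ × ℝ × ℝ => -(w.2.1) / 2 := by fun_prop
  have e : ∀ w, X1 P w = fderiv ℝ P w (1, 0, 0) +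
      fderiv ℝ (fun w => (-(w.2.1) / 2) * P w) w (0, 0, 1) := by
    intro w
    have h0 : fderiv ℝ (fun w : ℝ × ℝ × ℝ => -(w.2.1) / 2) w (0, 0, 1) = 0 := by
      have h : HasFDerivAt (fun w : ℝ × ℝ × ℝ => -(w.2.1) / 2) ((-(1 / 2 : ℝ)) •
          (ContinuousLinearMap.fst ℝ ℝ ℝ).comp (ContinuousLinearMap.snd ℝ ℝ (ℝ × ℝ))) w := by
        refine (ContinuousLinearMap.hasFDerivAt _).congr_of_eventuallyEq
          (Filter.Eventually.of_forall fun w => ?_)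
        simp; ring
      rw [h.fderiv]; simp
    rw [fderiv_fun_mul (hl.differentiable one_ne_zero w) (hP.differentiable one_ne_zero w)]
    simp only [add_apply, smul_apply, smul_eq_mul, h0, mul_zero, add_zero, X1]
    rw [← smul_eq_mul, ← map_smul, ← map_add]
    simp
  obtain ⟨i1, z1⟩ := integral_fderiv_apply_eq_zero hP hc (1, 0, 0)
  obtain ⟨i2, z2⟩ := integral_fderiv_apply_eq_zero (hl.mul hP) hc.mul_left (0, 0, 1)
  simp_rw [e]
  rw [integral_add i1 i2, z1, z2, add_zero]

lemma integral_X2_eq_zero {P : ℝ × ℝ × ℝ → ℝ} (hP : ContDiff ℝ 1 P)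
    (hc : HasCompactSupport P) : ∫ w, X2 P w = 0 := by
  have hl : ContDiff ℝ 1 fun w : ℝ × ℝ × ℝ => w.1 / 2 := by fun_prop
  have e : ∀ w, X2 P w = fderiv ℝ P w (0, 1, 0) +
      fderiv ℝ (fun w => (w.1 / 2) * P w) w (0, 0, 1) := by
    intro w
    have h0 : fderiv ℝ (fun w : ℝ × ℝ × ℝ => w.1 / 2) w (0, 0, 1) = 0 := by
      have h : HasFDerivAt (fun w : ℝ × ℝ × ℝ => w.1 / 2) ((1 / 2 : ℝ) •
          (ContinuousLinearMap.fst ℝ ℝ (ℝ × ℝ))) w := by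
        refine (ContinuousLinearMap.hasFDerivAt _).congr_of_eventuallyEq
          (Filter.Eventually.of_forall fun w => ?_)
        simp; ring
      rw [h.fderiv]; simp
    rw [fderiv_fun_mul (hl.differentiable one_ne_zero w) (hP.differentiable one_ne_zero w)]
    simp only [add_apply, smul_apply, smul_eq_mul, h0, mul_zero, add_zero, X2]
    rw [← smul_eq_mul, ← map_smul, ← map_add]
    simp
  obtain ⟨i1, z1⟩ := integral_fderiv_apply_eq_zero hP hc (0, 1, 0)
  obtain ⟨i2, z2⟩ := integral_fderiv_apply_eq_zero (hl.mul hP) hc.mul_left (0, 0, 1)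
  simp_rw [e]
  rw [integral_add i1 i2, z1, z2, add_zero]

/-- The function `K ^ α (1 + K ^ γ S) ^ (-1/2) (4 K ^ (-1/2) T - X)`, which gives the components
of the vector field used to integrate by parts. -/
noncomputable def fieldProfile (α γ K S T X : ℝ) : ℝ :=
  K ^ α * (1 + K ^ γ * S) ^ (-(1 / 2) : ℝ) * (4 * K ^ (-(1 / 2) : ℝ) * T - X)

lemma hasDerivAt_fieldProfile {α γ : ℝ} {K S T X : ℝ → ℝ} {r : ℝ}
    (hK : HasDerivAt K (4 * T r) r) (hS : HasDerivAt S (2 * X r) r)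
    (hT : HasDerivAt T (3 * S r) r) (hX : HasDerivAt X 1 r) (hK0 : 0 < K r) (hS0 : 0 ≤ S r) :
    HasDerivAt (fun r => fieldProfile α γ (K r) (S r) (T r) (X r))
      (K r ^ α * (1 + K r ^ γ * S r) ^ (-(1 / 2) : ℝ) *
        ((4 * α * T r / K r - (4 * γ * (K r ^ γ * S r) * T r / K r + 2 * K r ^ γ * X r) / 2 /
          (1 + K r ^ γ * S r)) * (4 * K r ^ (-(1 / 2) : ℝ) * T r - X r) -
          8 * K r ^ (-(1 / 2) : ℝ) * T r ^ 2 / K r + 12 * K r ^ (-(1 / 2) : ℝ) * S r - 1)) r := by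
  unfold fieldProfile
  have hz : 0 < 1 + K r ^ γ * S r := by positivity
  have h1 := (hK.rpow_const (p := α) (Or.inl hK0.ne')).mul
    ((((hK.rpow_const (p := γ) (Or.inl hK0.ne')).mul hS).const_add 1).rpow_const
      (p := (-(1 / 2) : ℝ)) (Or.inl hz.ne'))
  have h2 := (((hK.rpow_const (p := (-(1 / 2) : ℝ)) (Or.inl hK0.ne')).const_mul 4).mul hT).sub hX
  refine (h1.mul h2).congr_deriv ?_
  simp only [Pi.mul_apply, Pi.sub_apply]
  rw [Real.rpow_sub_one hK0.ne', Real.rpow_sub_one hK0.ne', Real.rpow_sub_one hK0.ne',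
    Real.rpow_sub_one hz.ne']
  field_simp
  ring

lemma drift_scalar_bound {p α γ M s k g P c : ℝ} (hp : 2 < p) (hα0 : 0 ≤ α) (hγ : γ = (p - 2) / 4)
    (hαγ : α ≤ γ) (hM : 144 ≤ M) (hs : 0 ≤ s) (hsM : s ^ 2 ≤ M) (hk : 0 < k)
    (hkM : k ^ 2 * (1 + M) = 1) (hg : 0 < g) (hP : 12 ≤ P) (hc : c * (g * s) ≤ k * s * P) :
    1 + c * (g * s) ≤ p * P / M * (s * (4 * k * M - s)) -
      4 * α * (s * (4 * k * M - s)) / (1 + M) +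
      (4 * γ * (g * s) * (s * (4 * k * M - s)) / (1 + M) + 2 * g * (s * (4 * k * s - 1))) / 2 /
        (1 + g * s) + 8 * k * (s * M) / (1 + M) - 24 * k * s + 2 := by
  have hM0 : 0 < M := by linarith
  have hγ0 : 0 ≤ γ := by rw [hγ]; linarith
  have hsk : s ≤ k * (1 + M) := by
    refine abs_le_of_sq_le_sq' ?_ (by positivity) |>.2
    calc s ^ 2 ≤ 1 + M := by linarith
      _ = (k ^ 2 * (1 + M)) * (1 + M) := by rw [hkM, one_mul]
      _ = _ := by ring
  have hm1 : 2 * k * M ≤ 4 * k * M - s := by nlinarith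
  have hm0 : 0 ≤ 4 * k * M - s := by nlinarith
  have t1 : 2 * p * P * s * k ≤ p * P / M * (s * (4 * k * M - s)) := by
    calc 2 * p * P * s * k = p * P / M * (s * (2 * k * M)) := by field_simp
      _ ≤ _ := by gcongr
  have t2 : 4 * α * (s * (4 * k * M - s)) / (1 + M) ≤ 16 * α * k * s := by
    rw [div_le_iff₀ (by positivity)]
    have : 4 * α * (s * (4 * k * M - s)) ≤ 4 * α * (s * (4 * k * (1 + M))) := by
      gcongr; nlinarith
    linarith
  have t3 : -1 ≤ (4 * γ * (g * s) * (s * (4 * k * M - s)) / (1 + M) +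
      2 * g * (s * (4 * k * s - 1))) / 2 / (1 + g * s) := by
    have h1 : 0 ≤ 4 * γ * (g * s) * (s * (4 * k * M - s)) / (1 + M) := by positivity
    have h2 : 0 ≤ g * s * (k * s) := by positivity
    rw [le_div_iff₀ (by positivity)]
    nlinarith
  have t4 : 0 ≤ 8 * k * (s * M) / (1 + M) := by positivity
  have t5 : 16 * α * k * s ≤ (4 * p - 8) * (k * s) := by
    have : 0 ≤ k * s := by positivity
    nlinarith
  have t6 : (4 * p - 8) * (k * s) + 24 * (k * s) + k * s * P ≤ 2 * p * P * s * k := by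
    have : 0 ≤ k * s := by positivity
    have h3 : (4 * p - 8) + 24 + P ≤ 2 * p * P := by nlinarith
    nlinarith
  linarith

/-- The squared Euclidean norm of the horizontal part. -/
noncomputable def radSq (w : ℝ × ℝ × ℝ) : ℝ := w.1 ^ 2 + w.2.1 ^ 2

/-- One quarter of the `X1` derivative of `gaugeK`. -/
noncomputable def gaugeX1 (w : ℝ × ℝ × ℝ) : ℝ := radSq w * w.1 - 4 * w.2.2 * w.2.1

/-- One quarter of the `X2` derivative of `gaugeK`. -/
noncomputable def gaugeX2 (w : ℝ × ℝ × ℝ) : ℝ := radSq w * w.2.1 + 4 * w.2.2 * w.1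

/-- The `X1` component of the vector field used to integrate by parts. -/
noncomputable def field1 (α γ : ℝ) (w : ℝ × ℝ × ℝ) : ℝ :=
  fieldProfile α γ (gaugeK w) (radSq w) (gaugeX1 w) w.1

/-- The `X2` component of the vector field used to integrate by parts. -/
noncomputable def field2 (α γ : ℝ) (w : ℝ × ℝ × ℝ) : ℝ :=
  fieldProfile α γ (gaugeK w) (radSq w) (gaugeX2 w) w.2.1

lemma radSq_nonneg (w : ℝ × ℝ × ℝ) : 0 ≤ radSq w := by unfold radSq; positivity

lemma gaugeK_pos (w : ℝ × ℝ × ℝ) : 0 < gaugeK w := by unfold gaugeK; positivity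

lemma contDiff_gaugeK : ContDiff ℝ 1 gaugeK := by unfold gaugeK; fun_prop

lemma contDiff_gaugeK_rpow (a : ℝ) : ContDiff ℝ 1 fun w => gaugeK w ^ a :=
  contDiff_gaugeK.rpow_const_of_ne fun w => (gaugeK_pos w).ne'

lemma contDiff_fieldProfile (α γ : ℝ) {T X : ℝ × ℝ × ℝ → ℝ} (hT : ContDiff ℝ 1 T)
    (hX : ContDiff ℝ 1 X) :
    ContDiff ℝ 1 fun w => fieldProfile α γ (gaugeK w) (radSq w) (T w) (X w) := by
  unfold fieldProfile
  have hS : ContDiff ℝ 1 radSq := by unfold radSq; fun_prop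
  have h1 : ContDiff ℝ 1 fun w => (1 + gaugeK w ^ γ * radSq w) ^ (-(1 / 2) : ℝ) := by
    refine ContDiff.rpow_const_of_ne (contDiff_const.add ((contDiff_gaugeK_rpow γ).mul hS)) ?_
    intro w
    have := radSq_nonneg w
    have := gaugeK_pos w
    positivity
  exact ((contDiff_gaugeK_rpow α).mul h1).mul
    (((contDiff_const.mul (contDiff_gaugeK_rpow _)).mul hT).sub hX)

lemma contDiff_field1 (α γ : ℝ) : ContDiff ℝ 1 (field1 α γ) :=
  contDiff_fieldProfile α γ (by unfold gaugeX1 radSq; fun_prop) contDiff_fst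

lemma contDiff_field2 (α γ : ℝ) : ContDiff ℝ 1 (field2 α γ) :=
  contDiff_fieldProfile α γ (by unfold gaugeX2 radSq; fun_prop) (by fun_prop)

lemma KaplanH_rpow (w : ℝ × ℝ × ℝ) (p : ℝ) : KaplanH w ^ p = (gaugeK w - 1) ^ (p / 4) := by
  unfold KaplanH gaugeK
  rw [← Real.rpow_mul (by positivity)]
  congr 1
  · ring
  · ring

lemma contDiff_KaplanH_rpow {p : ℝ} (hp : 2 < p) : ContDiff ℝ 1 fun w => KaplanH w ^ p := by
  have e : (fun w => KaplanH w ^ p) =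
      fun w : ℝ × ℝ × ℝ => ‖!₂[radSq w, 4 * w.2.2]‖ ^ (p / 2) := by
    funext w
    rw [EuclideanSpace.norm_eq, Real.sqrt_eq_rpow, ← Real.rpow_mul (by positivity), KaplanH_rpow]
    simp only [Fin.sum_univ_two, Real.norm_eq_abs, sq_abs, gaugeK, radSq]
    congr 1
    · simp; ring
    · ring
  rw [e]
  refine ContDiff.norm_rpow ?_ (by linarith)
  rw [contDiff_euclidean]
  intro i
  fin_cases i
  · simp [radSq]; fun_prop
  · simp; fun_prop

section flow

variable (w : ℝ × ℝ × ℝ)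

lemma hasDerivAt_flowX1_coord :
    HasDerivAt (fun s => (flowX1 s w).1) 1 0 ∧ HasDerivAt (fun s => (flowX1 s w).2.1) 0 0 ∧
      HasDerivAt (fun s => (flowX1 s w).2.2) (-(w.2.1) / 2) 0 := by
  refine ⟨(hasDerivAt_id (0 : ℝ)).const_add w.1, hasDerivAt_const _ _, ?_⟩
  simpa [flowX1, neg_div] using
    (((hasDerivAt_id (0 : ℝ)).mul_const w.2.1).div_const 2).const_sub w.2.2

lemma hasDerivAt_flowX2_coord :
    HasDerivAt (fun s => (flowX2 s w).1) 0 0 ∧ HasDerivAt (fun s => (flowX2 s w).2.1) 1 0 ∧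
      HasDerivAt (fun s => (flowX2 s w).2.2) (w.1 / 2) 0 := by
  refine ⟨hasDerivAt_const _ _, (hasDerivAt_id (0 : ℝ)).const_add w.2.1, ?_⟩
  simpa [flowX2] using
    (((hasDerivAt_id (0 : ℝ)).mul_const w.1).div_const 2).const_add w.2.2

lemma hasDerivAt_flowX1_gauge :
    HasDerivAt (fun s => radSq (flowX1 s w)) (2 * w.1) 0 ∧
      HasDerivAt (fun s => gaugeX1 (flowX1 s w)) (3 * radSq w) 0 ∧
      HasDerivAt (fun s => gaugeK (flowX1 s w)) (4 * gaugeX1 w) 0 := by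
  obtain ⟨h1, h2, h3⟩ := hasDerivAt_flowX1_coord w
  have hS : HasDerivAt (fun s => radSq (flowX1 s w)) (2 * w.1) 0 :=
    ((h1.pow 2).add (h2.pow 2)).congr_deriv (by simp [flowX1])
  refine ⟨hS, ?_, ?_⟩
  · refine ((hS.mul h1).sub ((h3.const_mul 4).mul h2)).congr_deriv ?_
    simp [flowX1, radSq]; ring
  · refine (((hS.pow 2).add ((h3.pow 2).const_mul 16)).const_add 1).congr_deriv ?_
    simp [flowX1, radSq, gaugeX1]; ring

lemma hasDerivAt_flowX2_gauge :
    HasDerivAt (fun s => radSq (flowX2 s w)) (2 * w.2.1) 0 ∧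
      HasDerivAt (fun s => gaugeX2 (flowX2 s w)) (3 * radSq w) 0 ∧
      HasDerivAt (fun s => gaugeK (flowX2 s w)) (4 * gaugeX2 w) 0 := by
  obtain ⟨h1, h2, h3⟩ := hasDerivAt_flowX2_coord w
  have hS : HasDerivAt (fun s => radSq (flowX2 s w)) (2 * w.2.1) 0 :=
    ((h1.pow 2).add (h2.pow 2)).congr_deriv (by simp [flowX2])
  refine ⟨hS, ?_, ?_⟩
  · refine ((hS.mul h2).add ((h3.const_mul 4).mul h1)).congr_deriv ?_
    simp [flowX2, radSq]; ring
  · refine (((hS.pow 2).add ((h3.pow 2).const_mul 16)).const_add 1).congr_deriv ?_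
    simp [flowX2, radSq, gaugeX2]; ring

end flow

lemma X1_KaplanH_rpow {p : ℝ} (hp : 2 < p) {w : ℝ × ℝ × ℝ} (hw : 1 < gaugeK w) :
    X1 (fun w => KaplanH w ^ p) w = p * (gaugeK w - 1) ^ (p / 4) / (gaugeK w - 1) * gaugeX1 w := by
  refine X1_eq_of_hasDerivAt ((contDiff_KaplanH_rpow hp).differentiable one_ne_zero) ?_
  simp_rw [KaplanH_rpow]
  have e : flowX1 0 w = w := by simp [flowX1]
  have hne : gaugeK w - 1 ≠ 0 := by linarith
  have h := ((hasDerivAt_flowX1_gauge w).2.2.sub_const 1).rpow_const (p := p / 4)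
    (Or.inl (by rwa [e]))
  refine h.congr_deriv ?_
  rw [e, Real.rpow_sub_one hne]
  ring

lemma X2_KaplanH_rpow {p : ℝ} (hp : 2 < p) {w : ℝ × ℝ × ℝ} (hw : 1 < gaugeK w) :
    X2 (fun w => KaplanH w ^ p) w = p * (gaugeK w - 1) ^ (p / 4) / (gaugeK w - 1) * gaugeX2 w := by
  refine X2_eq_of_hasDerivAt ((contDiff_KaplanH_rpow hp).differentiable one_ne_zero) ?_
  simp_rw [KaplanH_rpow]
  have e : flowX2 0 w = w := by simp [flowX2]
  have hne : gaugeK w - 1 ≠ 0 := by linarith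
  have h := ((hasDerivAt_flowX2_gauge w).2.2.sub_const 1).rpow_const (p := p / 4)
    (Or.inl (by rwa [e]))
  refine h.congr_deriv ?_
  rw [e, Real.rpow_sub_one hne]
  ring

/-- The drift `V · ∇U - div V` of the vector field `V` relative to the potential `U = N ^ p`. -/
noncomputable def drift (p α γ : ℝ) (w : ℝ × ℝ × ℝ) : ℝ :=
  field1 α γ w * X1 (fun w => KaplanH w ^ p) w + field2 α γ w * X2 (fun w => KaplanH w ^ p) w -
    X1 (field1 α γ) w - X2 (field2 α γ) w

lemma continuous_drift {p : ℝ} (hp : 2 < p) (α γ : ℝ) : Continuous (drift p α γ) :=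
  ((((contDiff_field1 α γ).continuous.mul (continuous_X1 (contDiff_KaplanH_rpow hp))).add
    ((contDiff_field2 α γ).continuous.mul (continuous_X2 (contDiff_KaplanH_rpow hp)))).sub
    (continuous_X1 (contDiff_field1 α γ))).sub (continuous_X2 (contDiff_field2 α γ))

lemma drift_eq {p : ℝ} (hp : 2 < p) (α γ : ℝ) {w : ℝ × ℝ × ℝ} (hw : 1 < gaugeK w)
    {M s k g : ℝ} (hM : M = gaugeK w - 1) (hs : s = radSq w) (hk : k = gaugeK w ^ (-(1 / 2) : ℝ))
    (hg : g = gaugeK w ^ γ) :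
    drift p α γ w = gaugeK w ^ α * (1 + g * s) ^ (-(1 / 2) : ℝ) *
      (p * M ^ (p / 4) / M * (s * (4 * k * M - s)) -
      4 * α * (s * (4 * k * M - s)) / (1 + M) +
      (4 * γ * (g * s) * (s * (4 * k * M - s)) / (1 + M) + 2 * g * (s * (4 * k * s - 1))) / 2 /
        (1 + g * s) + 8 * k * (s * M) / (1 + M) - 24 * k * s + 2) := by
  have e1 : flowX1 0 w = w := by simp [flowX1]
  have e2 : flowX2 0 w = w := by simp [flowX2]
  obtain ⟨hS1, hT1, hK1⟩ := hasDerivAt_flowX1_gauge w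
  have d1 := X1_eq_of_hasDerivAt ((contDiff_field1 α γ).differentiable one_ne_zero)
    (hasDerivAt_fieldProfile (α := α) (γ := γ) (K := fun s => gaugeK (flowX1 s w))
      (S := fun s => radSq (flowX1 s w)) (T := fun s => gaugeX1 (flowX1 s w))
      (X := fun s => (flowX1 s w).1) (r := 0) (by simpa only [e1] using hK1)
      (by simpa only [e1] using hS1) (by simpa only [e1] using hT1)
      (hasDerivAt_flowX1_coord w).1 (gaugeK_pos _) (radSq_nonneg _))
  simp only [e1] at d1
  obtain ⟨hS2, hT2, hK2⟩ := hasDerivAt_flowX2_gauge w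
  have d2 := X2_eq_of_hasDerivAt ((contDiff_field2 α γ).differentiable one_ne_zero)
    (hasDerivAt_fieldProfile (α := α) (γ := γ) (K := fun s => gaugeK (flowX2 s w))
      (S := fun s => radSq (flowX2 s w)) (T := fun s => gaugeX2 (flowX2 s w))
      (X := fun s => (flowX2 s w).2.1) (r := 0) (by simpa only [e2] using hK2)
      (by simpa only [e2] using hS2) (by simpa only [e2] using hT2)
      (hasDerivAt_flowX2_coord w).2.1 (gaugeK_pos _) (radSq_nonneg _))
  simp only [e2] at d2
  have hK : gaugeK w = 1 + M := by linarith
  have hzz : 0 < 1 + g * s := by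
    have := radSq_nonneg w
    have := gaugeK_pos w
    rw [hg, hs]; positivity
  have hT2 : gaugeX1 w ^ 2 + gaugeX2 w ^ 2 = s * M := by
    rw [hs, hM]; unfold gaugeX1 gaugeX2 gaugeK radSq; ring
  have hXT : w.1 * gaugeX1 w + w.2.1 * gaugeX2 w = s ^ 2 := by
    rw [hs]; unfold gaugeX1 gaugeX2 radSq; ring
  have hX2 : w.1 ^ 2 + w.2.1 ^ 2 = s := hs.symm
  rw [drift, d1, d2, X1_KaplanH_rpow hp hw, X2_KaplanH_rpow hp hw, field1, field2]
  unfold fieldProfile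
  rw [← hs, ← hk, ← hg, ← hM, hK]
  have hM0 : M ≠ 0 := by linarith
  have hM1 : 1 + M ≠ 0 := by linarith
  generalize (1 + M) ^ α * (1 + g * s) ^ (-(1 / 2) : ℝ) = E
  generalize M ^ (p / 4) = P
  have i1 : gaugeX1 w * (4 * k * gaugeX1 w - w.1) + gaugeX2 w * (4 * k * gaugeX2 w - w.2.1) =
      s * (4 * k * M - s) := by linear_combination 4 * k * hT2 - hXT
  have i2 : w.1 * (4 * k * gaugeX1 w - w.1) + w.2.1 * (4 * k * gaugeX2 w - w.2.1) =
      s * (4 * k * s - 1) := by linear_combination 4 * k * hXT - hX2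
  linear_combination (E * p * P / M - E * 4 * α / (1 + M) +
    E * 4 * γ * (g * s) / (1 + M) / 2 / (1 + g * s)) * i1 + E * g / (1 + g * s) * i2 +
    8 * k / (1 + M) * E * hT2

lemma rpow_gaugeK_le_drift {p α γ : ℝ} (hp : 2 < p) (hγ : γ = (p - 2) / 4) (hα0 : 0 ≤ α)
    (hαγ : α ≤ γ) {w : ℝ × ℝ × ℝ} (hw : 145 ≤ gaugeK w) :
    (1 / 2) ^ p * gaugeK w ^ α ≤ drift p α γ w := by
  have hK0 := gaugeK_pos w
  rw [drift_eq hp α γ (by linarith) rfl rfl rfl rfl]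
  set K := gaugeK w with hK
  set s := radSq w with hs
  have hs0 : 0 ≤ s := radSq_nonneg w
  have hsM : s ^ 2 ≤ K - 1 := by
    rw [hs, hK]; unfold gaugeK radSq; nlinarith [sq_nonneg w.2.2]
  have hg : 0 < K ^ γ := Real.rpow_pos_of_pos hK0 _
  have hk : 0 < K ^ (-(1 / 2) : ℝ) := Real.rpow_pos_of_pos hK0 _
  have hc0 : (0 : ℝ) < (1 / 2) ^ p := by positivity
  have hc1 : (1 / 2 : ℝ) ^ p ≤ 1 := Real.rpow_le_one (by norm_num) (by norm_num) (by linarith)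
  have hP : 12 ≤ (K - 1) ^ (p / 4) := by
    calc (12 : ℝ) = (144 : ℝ) ^ (1 / 2 : ℝ) := by
          rw [show (144 : ℝ) = 12 ^ (2 : ℝ) by norm_num, ← Real.rpow_mul (by norm_num)]; norm_num
      _ ≤ (K - 1) ^ (1 / 2 : ℝ) := Real.rpow_le_rpow (by norm_num) (by linarith) (by norm_num)
      _ ≤ _ := Real.rpow_le_rpow_of_exponent_le (by linarith) (by linarith)
  have hcP : (1 / 2) ^ p * (K ^ γ * s) ≤ K ^ (-(1 / 2) : ℝ) * s * (K - 1) ^ (p / 4) := by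
    have h1 : (1 / 2 : ℝ) ^ p ≤ (1 / 2) ^ (p / 4) :=
      Real.rpow_le_rpow_of_exponent_ge (by norm_num) (by norm_num) (by linarith)
    have h2 : K ^ γ = K ^ (-(1 / 2) : ℝ) * K ^ (p / 4) := by
      rw [← Real.rpow_add hK0]; congr 1; rw [hγ]; ring
    have h3 : (1 / 2 : ℝ) ^ (p / 4) * K ^ (p / 4) ≤ (K - 1) ^ (p / 4) := by
      rw [← Real.mul_rpow (by norm_num) hK0.le]
      exact Real.rpow_le_rpow (by positivity) (by linarith) (by linarith)
    calc (1 / 2) ^ p * (K ^ γ * s) ≤ (1 / 2) ^ (p / 4) * (K ^ γ * s) := by gcongr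
      _ = K ^ (-(1 / 2) : ℝ) * s * ((1 / 2) ^ (p / 4) * K ^ (p / 4)) := by rw [h2]; ring
      _ ≤ _ := by gcongr
  have h := drift_scalar_bound hp hα0 hγ hαγ (by linarith) hs0 hsM hk
    (by rw [← Real.rpow_natCast, ← Real.rpow_mul hK0.le, add_sub_cancel]
        norm_num
        rw [Real.rpow_neg_one, inv_mul_cancel₀ hK0.ne']) hg hP hcP
  have hz : 0 ≤ K ^ γ * s := by positivity
  have hone : 1 ≤ (1 + K ^ γ * s) ^ (-(1 / 2) : ℝ) * (1 + K ^ γ * s) := by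
    rw [← Real.rpow_add_one (by positivity)]
    exact Real.one_le_rpow (by linarith) (by norm_num)
  calc (1 / 2) ^ p * K ^ α
      ≤ (1 / 2) ^ p * K ^ α * ((1 + K ^ γ * s) ^ (-(1 / 2) : ℝ) * (1 + K ^ γ * s)) :=
        le_mul_of_one_le_right (by positivity) hone
    _ = K ^ α * (1 + K ^ γ * s) ^ (-(1 / 2) : ℝ) * ((1 / 2) ^ p * (1 + K ^ γ * s)) := by ring
    _ ≤ _ := by
        gcongr
        refine le_trans ?_ h
        linarith

lemma isCompact_gaugeK_le (κ : ℝ) : IsCompact {w | gaugeK w ≤ κ} := by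
  refine (isCompact_Icc (a := ((-(1 + κ), -(1 + κ), -(1 + κ)) : ℝ × ℝ × ℝ))
    (b := (1 + κ, 1 + κ, 1 + κ))).of_isClosed_subset (isClosed_gaugeK_le κ) ?_
  rintro ⟨x, y, t⟩ h
  simp only [mem_ofPred_eq, gaugeK] at h
  have hx : x ^ 2 ≤ κ := by nlinarith [sq_nonneg (x ^ 2 + y ^ 2 - 1), sq_nonneg y, sq_nonneg t]
  have hy : y ^ 2 ≤ κ := by nlinarith [sq_nonneg (x ^ 2 + y ^ 2 - 1), sq_nonneg x, sq_nonneg t]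
  have ht : t ^ 2 ≤ κ := by nlinarith [sq_nonneg (x ^ 2 + y ^ 2), sq_nonneg t]
  simp only [mem_Icc, Prod.mk_le_mk]
  refine ⟨⟨?_, ?_, ?_⟩, ?_, ?_, ?_⟩ <;> nlinarith

lemma exists_rpow_gaugeK_sub_le_drift {p α γ : ℝ} (hp : 2 < p) (hγ : γ = (p - 2) / 4)
    (hα0 : 0 ≤ α) (hαγ : α ≤ γ) :
    ∃ D, 0 ≤ D ∧ ∀ w, (1 / 2) ^ p * gaugeK w ^ α - D ≤ drift p α γ w := by
  obtain ⟨D, hD⟩ := (isCompact_gaugeK_le 145).exists_bound_of_continuousOn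
    (f := fun w => (1 / 2) ^ p * gaugeK w ^ α - drift p α γ w)
    ((continuous_const.mul (contDiff_gaugeK_rpow α).continuous).sub
      (continuous_drift hp α γ)).continuousOn
  refine ⟨max D 0, le_max_right _ _, fun w => ?_⟩
  rcases le_total (gaugeK w) 145 with h | h
  · have := (le_abs_self _).trans (hD w h)
    linarith [le_max_left D 0]
  · linarith [rpow_gaugeK_le_drift hp hγ hα0 hαγ h, le_max_right D 0]

lemma field_sq_le (α γ : ℝ) (w : ℝ × ℝ × ℝ) :
    field1 α γ w ^ 2 + field2 α γ w ^ 2 ≤ 25 * gaugeK w ^ (2 * α - γ) := by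
  have hK0 := gaugeK_pos w
  have hs0 := radSq_nonneg w
  have hT2 : gaugeX1 w ^ 2 + gaugeX2 w ^ 2 = radSq w * (gaugeK w - 1) := by
    unfold gaugeX1 gaugeX2 gaugeK radSq; ring
  have hXT : w.1 * gaugeX1 w + w.2.1 * gaugeX2 w = radSq w ^ 2 := by
    unfold gaugeX1 gaugeX2 radSq; ring
  have hX2 : w.1 ^ 2 + w.2.1 ^ 2 = radSq w := rfl
  unfold field1 field2 fieldProfile
  set K := gaugeK w
  set s := radSq w
  have hz : 0 < 1 + K ^ γ * s := by positivity
  have hk : (K ^ (-(1 / 2) : ℝ)) ^ 2 * K = 1 := by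
    rw [← Real.rpow_natCast, ← Real.rpow_mul hK0.le]
    norm_num
    rw [Real.rpow_neg_one, inv_mul_cancel₀ hK0.ne']
  have hk0 : 0 < K ^ (-(1 / 2) : ℝ) := Real.rpow_pos_of_pos hK0 _
  generalize K ^ (-(1 / 2) : ℝ) = k at hk hk0
  have hE : (K ^ α * (1 + K ^ γ * s) ^ (-(1 / 2) : ℝ)) ^ 2 * s ≤ K ^ (2 * α - γ) := by
    have e1 : (K ^ α) ^ 2 = K ^ (2 * α - γ) * K ^ γ := by
      rw [← Real.rpow_natCast, ← Real.rpow_mul hK0.le, ← Real.rpow_add hK0]; congr 1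
      push_cast; ring
    have e2 : ((1 + K ^ γ * s) ^ (-(1 / 2) : ℝ)) ^ 2 = (1 + K ^ γ * s)⁻¹ := by
      rw [← Real.rpow_natCast, ← Real.rpow_mul hz.le]; norm_num [Real.rpow_neg_one]
    rw [mul_pow, e1, e2]
    calc _ = K ^ (2 * α - γ) * ((K ^ γ * s) / (1 + K ^ γ * s)) := by ring
      _ ≤ K ^ (2 * α - γ) * 1 := by
        gcongr
        rw [div_le_one hz]; linarith
      _ = _ := mul_one _
  generalize K ^ α * (1 + K ^ γ * s) ^ (-(1 / 2) : ℝ) = E at hE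
  calc _ = E ^ 2 * (16 * k ^ 2 * (s * (K - 1)) - 8 * k * s ^ 2 + s) := by
        linear_combination E ^ 2 * 16 * k ^ 2 * hT2 - E ^ 2 * 8 * k * hXT + E ^ 2 * hX2
    _ ≤ E ^ 2 * (25 * s) := by
        gcongr
        have h1 : 0 ≤ k * s ^ 2 := by positivity
        have h2 : 0 ≤ k ^ 2 * s := by positivity
        have h3 : 16 * k ^ 2 * (s * (K - 1)) = 16 * s * (k ^ 2 * K) - 16 * (k ^ 2 * s) := by ring
        rw [h3, hk]; linarith
    _ ≤ _ := by linarith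

lemma young_field_le {p q α γ : ℝ} (hp : 2 < p) (hq : q = p / (p - 1))
    (hα : α = γ * q / 2) {F v g K : ℝ} (hF : 0 ≤ F) (hg : 0 ≤ g)
    (hK : 0 < K) (hv : v ≤ 25 * K ^ (2 * α - γ)) :
    q * F ^ (q - 1) * (√v * √g) ≤
      (1 / 2) ^ p / 2 * (F ^ q * K ^ α) + (10 * q) ^ q * g ^ (q / 2) := by
  have hp1 : 0 < p - 1 := by linarith
  have hpq : p.HolderConjugate q := by
    rw [Real.holderConjugate_iff]
    refine ⟨by linarith, ?_⟩
    rw [hq]; field_simp; ring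
  have hq1 : 1 < q := hpq.symm.lt
  have hqp : (q - 1) * p = q := by rw [hq]; field_simp; ring
  have hy := Real.young_inequality_of_nonneg (a := F ^ (q - 1) * √v / 10) (b := 10 * q * √g)
    (by positivity) (by positivity) hpq
  have e1 : (F ^ (q - 1) * √v / 10) ^ p ≤ (1 / 2) ^ p * (F ^ q * K ^ α) := by
    have h1 : √v ≤ 5 * K ^ (α / p) := by
      rw [Real.sqrt_le_left (by positivity)]
      refine hv.trans_eq ?_
      rw [mul_pow, ← Real.rpow_natCast (K ^ _), ← Real.rpow_mul hK.le]
      congr 1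
      · norm_num
      · congr 1
        push_cast
        rw [hα, hq]; field_simp; ring
    calc (F ^ (q - 1) * √v / 10) ^ p ≤ (F ^ (q - 1) * (5 * K ^ (α / p)) / 10) ^ p := by gcongr
      _ = ((1 / 2) * (F ^ (q - 1) * K ^ (α / p))) ^ p := by congr 1; ring
      _ = _ := by
        rw [Real.mul_rpow (by norm_num) (by positivity), Real.mul_rpow (by positivity)
          (by positivity), ← Real.rpow_mul hF, ← Real.rpow_mul hK.le, hqp,
          div_mul_cancel₀ _ (by linarith : p ≠ 0)]
  have e2 : (10 * q * √g) ^ q = (10 * q) ^ q * g ^ (q / 2) := by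
    rw [Real.mul_rpow (by positivity) (by positivity), Real.sqrt_eq_rpow, ← Real.rpow_mul hg]
    congr 2; ring
  have e3 : (F ^ (q - 1) * √v / 10) ^ p / p ≤ (1 / 2) ^ p / 2 * (F ^ q * K ^ α) := by
    calc _ ≤ (1 / 2) ^ p * (F ^ q * K ^ α) / 2 := by gcongr
      _ = _ := by ring
  have e4 : (10 * q * √g) ^ q / q ≤ (10 * q) ^ q * g ^ (q / 2) := by
    rw [e2]; exact div_le_self (by positivity) hq1.le
  calc _ = F ^ (q - 1) * √v / 10 * (10 * q * √g) := by ring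
    _ ≤ _ := hy
    _ ≤ _ := add_le_add e3 e4

/-- The density `|f| ^ q e ^ (-N ^ p)`. -/
noncomputable def powDensity (p q : ℝ) (f : ℝ × ℝ × ℝ → ℝ) (w : ℝ × ℝ × ℝ) : ℝ :=
  |f w| ^ q * Real.exp (-(KaplanH w) ^ p)

section powDensity

variable {p q : ℝ} {f : ℝ × ℝ × ℝ → ℝ}

lemma contDiff_exp_neg_KaplanH_rpow (hp : 2 < p) :
    ContDiff ℝ 1 fun w => Real.exp (-(KaplanH w) ^ p) :=
  (contDiff_KaplanH_rpow hp).neg.exp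

lemma contDiff_abs_rpow (hq : 1 < q) (hf : ContDiff ℝ 1 f) : ContDiff ℝ 1 fun w => |f w| ^ q :=
  hf.norm_rpow hq

lemma hasCompactSupport_abs_rpow (hq : 0 < q) (hc : HasCompactSupport f) :
    HasCompactSupport fun w => |f w| ^ q :=
  hc.comp_left (g := fun x => |x| ^ q) (by simp [hq.ne'])

lemma X1_powDensity (hp : 2 < p) (hq : 1 < q) (hf : ContDiff ℝ 1 f) (w : ℝ × ℝ × ℝ) :
    X1 (powDensity p q f) w = Real.exp (-(KaplanH w) ^ p) *
      (q * |f w| ^ (q - 2) * f w * X1 f w - |f w| ^ q * X1 (fun w => KaplanH w ^ p) w) := by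
  have hU := (contDiff_KaplanH_rpow hp).differentiable one_ne_zero
  have h1 : X1 (fun w => |f w| ^ q) w = _ :=
    X1_comp (hf.differentiable one_ne_zero) (hasDerivAt_norm_rpow (f w) hq)
  have h2 : X1 (fun w => Real.exp (-(KaplanH w) ^ p)) w = _ :=
    X1_comp (φ := fun u => Real.exp (-u)) hU (hasDerivAt_neg _).exp
  have h3 : X1 (powDensity p q f) w = _ :=
    X1_mul ((contDiff_abs_rpow hq hf).differentiable one_ne_zero)
      ((contDiff_exp_neg_KaplanH_rpow hp).differentiable one_ne_zero) w
  rw [h3, h1, h2, Real.norm_eq_abs]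
  ring

lemma X2_powDensity (hp : 2 < p) (hq : 1 < q) (hf : ContDiff ℝ 1 f) (w : ℝ × ℝ × ℝ) :
    X2 (powDensity p q f) w = Real.exp (-(KaplanH w) ^ p) *
      (q * |f w| ^ (q - 2) * f w * X2 f w - |f w| ^ q * X2 (fun w => KaplanH w ^ p) w) := by
  have hU := (contDiff_KaplanH_rpow hp).differentiable one_ne_zero
  have h1 : X2 (fun w => |f w| ^ q) w = _ :=
    X2_comp (hf.differentiable one_ne_zero) (hasDerivAt_norm_rpow (f w) hq)
  have h2 : X2 (fun w => Real.exp (-(KaplanH w) ^ p)) w = _ :=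
    X2_comp (φ := fun u => Real.exp (-u)) hU (hasDerivAt_neg _).exp
  have h3 : X2 (powDensity p q f) w = _ :=
    X2_mul ((contDiff_abs_rpow hq hf).differentiable one_ne_zero)
      ((contDiff_exp_neg_KaplanH_rpow hp).differentiable one_ne_zero) w
  rw [h3, h1, h2, Real.norm_eq_abs]
  ring

lemma contDiff_powDensity (hp : 2 < p) (hq : 1 < q) (hf : ContDiff ℝ 1 f) :
    ContDiff ℝ 1 (powDensity p q f) :=
  (contDiff_abs_rpow hq hf).mul (contDiff_exp_neg_KaplanH_rpow hp)

lemma continuous_powDensity (hp : 2 < p) (hq : 0 < q) (hf : Continuous f) :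
    Continuous (powDensity p q f) :=
  (hf.abs.rpow_const fun _ => Or.inr hq.le).mul (contDiff_exp_neg_KaplanH_rpow hp).continuous

lemma hasCompactSupport_powDensity (hq : 0 < q) (hc : HasCompactSupport f) :
    HasCompactSupport (powDensity p q f) :=
  (hasCompactSupport_abs_rpow hq hc).mul_right

end powDensity

/-- The density `|∇f| ^ q e ^ (-N ^ p)` for the horizontal gradient `∇f = (X1 f, X2 f)`. -/
noncomputable def gradDensity (p q : ℝ) (f : ℝ × ℝ × ℝ → ℝ) (w : ℝ × ℝ × ℝ) : ℝ :=
  (X1 f w ^ 2 + X2 f w ^ 2) ^ (q / 2) * Real.exp (-(KaplanH w) ^ p)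

lemma continuous_gradDensity {p q : ℝ} (hp : 2 < p) (hq : 0 < q) {f : ℝ × ℝ × ℝ → ℝ}
    (hf : ContDiff ℝ 1 f) : Continuous (gradDensity p q f) :=
  ((((continuous_X1 hf).pow 2).add ((continuous_X2 hf).pow 2)).rpow_const
    fun _ => Or.inr (by positivity)).mul (contDiff_exp_neg_KaplanH_rpow hp).continuous

lemma hasCompactSupport_gradDensity {p q : ℝ} (hq : 0 < q) {f : ℝ × ℝ × ℝ → ℝ}
    (hc : HasCompactSupport f) : HasCompactSupport (gradDensity p q f) := by
  refine HasCompactSupport.mul_right ?_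
  refine (hc.fderiv ℝ).mono' fun w hw => subset_tsupport _ fun h => hw ?_
  have h1 : X1 f w = 0 := by simp [X1, h]
  have h2 : X2 f w = 0 := by simp [X2, h]
  have : q / 2 ≠ 0 := by positivity
  simp [h1, h2, this]

lemma powDensity_drift_le {p q α γ : ℝ} (hp : 2 < p) (hq : q = p / (p - 1))
    (hα : α = γ * q / 2) {f : ℝ × ℝ × ℝ → ℝ} (hf : ContDiff ℝ 1 f) (w : ℝ × ℝ × ℝ) :
    powDensity p q f w * drift p α γ w ≤
      (1 / 2) ^ p / 2 * (powDensity p q f w * gaugeK w ^ α) + (10 * q) ^ q * gradDensity p q f w -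
        (X1 (fun w => powDensity p q f w * field1 α γ w) w +
          X2 (fun w => powDensity p q f w * field2 α γ w) w) := by
  have hq1 : 1 < q := by rw [hq, lt_div_iff₀ (by linarith)]; linarith
  have hd := (contDiff_powDensity hp hq1 hf).differentiable one_ne_zero
  rw [X1_mul hd ((contDiff_field1 α γ).differentiable one_ne_zero),
    X2_mul hd ((contDiff_field2 α γ).differentiable one_ne_zero), X1_powDensity hp hq1 hf,
    X2_powDensity hp hq1 hf]
  have hy := young_field_le hp hq hα (abs_nonneg (f w))
    (by positivity : 0 ≤ X1 f w ^ 2 + X2 f w ^ 2) (gaugeK_pos w) (field_sq_le α γ w)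
  have hcs : |field1 α γ w * X1 f w + field2 α γ w * X2 f w| ≤
      √(field1 α γ w ^ 2 + field2 α γ w ^ 2) * √(X1 f w ^ 2 + X2 f w ^ 2) := by
    rw [← Real.sqrt_mul (by positivity)]
    refine Real.abs_le_sqrt ?_
    nlinarith [sq_nonneg (field1 α γ w * X2 f w - field2 α γ w * X1 f w)]
  have habs : |f w| ^ (q - 2) * |f w| = |f w| ^ (q - 1) := by
    rcases eq_or_ne (f w) 0 with h | h
    · rw [h, abs_zero, mul_zero, Real.zero_rpow (by linarith)]
    · rw [← Real.rpow_add_one (abs_ne_zero.2 h)]; congr 1; ring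
  have hmain : q * |f w| ^ (q - 2) * f w * (field1 α γ w * X1 f w + field2 α γ w * X2 f w) ≤
      (1 / 2) ^ p / 2 * (|f w| ^ q * gaugeK w ^ α) +
        (10 * q) ^ q * (X1 f w ^ 2 + X2 f w ^ 2) ^ (q / 2) := by
    refine le_trans (le_abs_self _) (le_trans ?_ hy)
    rw [abs_mul, abs_mul, abs_mul, abs_of_pos (by linarith : 0 < q),
      abs_of_nonneg (by positivity : 0 ≤ |f w| ^ (q - 2)), mul_assoc q, habs]
    gcongr
  have := mul_le_mul_of_nonneg_right hmain (Real.exp_pos (-(KaplanH w) ^ p)).le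
  unfold drift powDensity gradDensity
  linarith

/-- Weighted energy bound: `|f| ^ q` stays integrable against a growing weight, at the cost of the
energy. -/
lemma exists_integral_powDensity_weight_le {p q α γ : ℝ} (hp : 2 < p) (hq : q = p / (p - 1))
    (hγ : γ = (p - 2) / 4) (hα : α = γ * q / 2) :
    ∃ A D, 0 ≤ A ∧ 0 ≤ D ∧ ∀ f : ℝ × ℝ × ℝ → ℝ, ContDiff ℝ 1 f → HasCompactSupport f →
      ∫ w, powDensity p q f w * gaugeK w ^ α ≤
        A * (∫ w, gradDensity p q f w) + D * ∫ w, powDensity p q f w := by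
  have hq1 : 1 < q := by rw [hq, lt_div_iff₀ (by linarith)]; linarith
  have hq2 : q ≤ 2 := by rw [hq, div_le_iff₀ (by linarith)]; linarith
  have hγ0 : 0 ≤ γ := by rw [hγ]; linarith
  obtain ⟨D, hD0, hD⟩ := exists_rpow_gaugeK_sub_le_drift (α := α) hp hγ
    (by rw [hα]; positivity) (by rw [hα]; nlinarith)
  set c : ℝ := (1 / 2) ^ p / 2 with hc
  have hc0 : 0 < c := by positivity
  refine ⟨c⁻¹ * (10 * q) ^ q, c⁻¹ * D, by positivity, by positivity, fun f hf hcs => ?_⟩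
  have hF := contDiff_powDensity hp hq1 hf
  have hFc := hasCompactSupport_powDensity (p := p) (by linarith : 0 < q) hcs
  have c1 := hF.mul (contDiff_field1 α γ)
  have c2 := hF.mul (contDiff_field2 α γ)
  have s1 : HasCompactSupport fun w => powDensity p q f w * field1 α γ w := hFc.mul_right
  have s2 : HasCompactSupport fun w => powDensity p q f w * field2 α γ w := hFc.mul_right
  have i0 : Integrable (powDensity p q f) := hF.continuous.integrable_of_hasCompactSupport hFc
  have iW : Integrable fun w => powDensity p q f w * gaugeK w ^ α :=
    (hF.continuous.mul (contDiff_gaugeK_rpow α).continuous).integrable_of_hasCompactSupport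
      hFc.mul_right
  have iG : Integrable (gradDensity p q f) :=
    (continuous_gradDensity hp (by linarith) hf).integrable_of_hasCompactSupport
      (hasCompactSupport_gradDensity (by linarith) hcs)
  have i1 : Integrable (X1 fun w => powDensity p q f w * field1 α γ w) :=
    (continuous_X1 c1).integrable_of_hasCompactSupport (hasCompactSupport_X1 s1)
  have i2 : Integrable (X2 fun w => powDensity p q f w * field2 α γ w) :=
    (continuous_X2 c2).integrable_of_hasCompactSupport (hasCompactSupport_X2 s2)
  have hpt : ∀ w, c * (powDensity p q f w * gaugeK w ^ α) ≤
      (10 * q) ^ q * gradDensity p q f w + D * powDensity p q f w -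
        (X1 (fun w => powDensity p q f w * field1 α γ w) w +
          X2 (fun w => powDensity p q f w * field2 α γ w) w) := by
    intro w
    have h0 : 0 ≤ powDensity p q f w := by unfold powDensity; positivity
    have h1 := mul_le_mul_of_nonneg_left (hD w) h0
    have h2 := powDensity_drift_le hp hq hα hf w
    rw [← hc] at h2
    have h3 : (1 / 2 : ℝ) ^ p = 2 * c := by rw [hc]; ring
    rw [h3] at h1
    linarith
  have hibp := integral_mono (iW.const_mul c)
    (((iG.const_mul ((10 * q) ^ q)).add (i0.const_mul D)).sub (i1.add i2)) hpt
  rw [integral_sub' ((iG.const_mul _).add (i0.const_mul _)) (i1.add i2), integral_add' i1 i2,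
    integral_add' (iG.const_mul _) (i0.const_mul _), integral_X1_eq_zero c1 s1,
    integral_X2_eq_zero c2 s2, integral_const_mul, integral_const_mul, integral_const_mul] at hibp
  calc _ = c⁻¹ * (c * ∫ w, powDensity p q f w * gaugeK w ^ α) := by field_simp
    _ ≤ c⁻¹ * ((10 * q) ^ q * (∫ w, gradDensity p q f w) + D * ∫ w, powDensity p q f w) := by
      gcongr; linarith
    _ = _ := by ring

lemma setLIntegral_le_exp_mul {p κ : ℝ} (hp : 2 < p) {u : ℝ × ℝ × ℝ → ℝ} (hu : ∀ w, 0 ≤ u w)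
    (hi : Integrable fun w => u w * Real.exp (-(KaplanH w) ^ p)) :
    ∫⁻ w in {w | gaugeK w ≤ κ}, ENNReal.ofReal (u w) ≤
      ENNReal.ofReal (Real.exp (κ ^ (p / 4)) * ∫ w, u w * Real.exp (-(KaplanH w) ^ p)) := by
  have h0 : ∀ w, 0 ≤ u w * Real.exp (-(KaplanH w) ^ p) := fun w => mul_nonneg (hu w) (by positivity)
  rw [← integral_const_mul, ofReal_integral_eq_lintegral_ofReal (hi.const_mul _)
    (ae_of_all _ fun w => mul_nonneg (by positivity) (h0 w))]
  refine le_trans (setLIntegral_mono' (isClosed_gaugeK_le κ).measurableSet fun w hw => ?_)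
    (setLIntegral_le_lintegral _ _)
  refine ENNReal.ofReal_le_ofReal ?_
  rw [mul_left_comm, ← Real.exp_add]
  refine le_mul_of_one_le_right (hu w) (Real.one_le_exp ?_)
  rw [KaplanH_rpow, ← sub_eq_add_neg, sub_nonneg]
  simp only [mem_ofPred_eq] at hw
  exact Real.rpow_le_rpow (by linarith [one_le_gaugeK w]) (by linarith) (by linarith)

lemma setIntegral_powDensity_le {p q : ℝ} (hp : 2 < p) (hq1 : 1 < q) (hq2 : q ≤ 2)
    {f : ℝ × ℝ × ℝ → ℝ} (hf : ContDiff ℝ 1 f) (hc : HasCompactSupport f) {κ δ : ℝ}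
    (hδ0 : 0 < δ) (hδ1 : δ ≤ 1) :
    ∫ w in {w | gaugeK w ≤ κ}, powDensity p q f w ≤
      2 * δ⁻¹ ^ 4 * (Real.exp ((145 ^ 3 * κ) ^ (p / 4)) * ∫ w, powDensity p (q / 2) f w) ^ 2 +
        27 * (2 * δ) ^ q * (Real.exp ((145 ^ 3 * κ) ^ (p / 4)) * ∫ w, gradDensity p q f w) := by
  have hq0 : 0 < q := by linarith
  have h0 : ∀ a w, 0 ≤ powDensity p a f w := fun a w => by unfold powDensity; positivity
  have h0' : ∀ w, 0 ≤ gradDensity p q f w := fun w => by unfold gradDensity; positivity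
  have hi : ∀ a, 0 < a → Integrable (powDensity p a f) := fun a ha =>
    (continuous_powDensity hp ha hf.continuous).integrable_of_hasCompactSupport
      (hasCompactSupport_powDensity ha hc)
  have hH := setLIntegral_le_exp_mul (κ := 145 ^ 3 * κ) hp (u := fun w => |f w| ^ (q / 2))
    (fun w => by positivity) (hi (q / 2) (by positivity))
  have hG := setLIntegral_le_exp_mul (κ := 145 ^ 3 * κ) hp
    (u := fun w => (X1 f w ^ 2 + X2 f w ^ 2) ^ (q / 2)) (fun w => by positivity)
    ((continuous_gradDensity hp hq0 hf).integrable_of_hasCompactSupport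
      (hasCompactSupport_gradDensity hq0 hc))
  have iH : 0 ≤ ∫ w, powDensity p (q / 2) f w := integral_nonneg (h0 _)
  have iG : 0 ≤ ∫ w, gradDensity p q f w := integral_nonneg h0'
  rw [← ENNReal.ofReal_le_ofReal_iff (by positivity),
    ofReal_integral_eq_lintegral_ofReal (hi q hq0).integrableOn (ae_of_all _ (h0 q)),
    ENNReal.ofReal_add (by positivity) (by positivity), pow_two,
    ENNReal.ofReal_mul (p := 2 * δ⁻¹ ^ 4) (by positivity),
    ENNReal.ofReal_mul
      (p := Real.exp ((145 ^ 3 * κ) ^ (p / 4)) * ∫ w, powDensity p (q / 2) f w) (by positivity),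
    ENNReal.ofReal_mul (p := 27 * (2 * δ) ^ q) (by positivity)]
  calc _ ≤ ∫⁻ w in {w | gaugeK w ≤ κ}, ENNReal.ofReal (|f w| ^ q) := by
        refine lintegral_mono fun w => ENNReal.ofReal_le_ofReal ?_
        refine mul_le_of_le_one_right (by positivity) (Real.exp_le_one_iff.2 ?_)
        have : 0 ≤ KaplanH w := by unfold KaplanH; positivity
        have : 0 ≤ KaplanH w ^ p := by positivity
        linarith
    _ ≤ _ := lintegral_rpow_le_local hf hq1.le hq2 hδ0 hδ1
    _ ≤ _ := add_le_add (mul_le_mul' le_rfl (mul_le_mul' hH hH)) (mul_le_mul' le_rfl hG)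

lemma integral_powDensity_le_split {p q α : ℝ} (hp : 2 < p) (hq : 0 < q) (hα : 0 ≤ α)
    {f : ℝ × ℝ × ℝ → ℝ} (hf : Continuous f) (hc : HasCompactSupport f) {κ : ℝ} (hκ : 0 < κ) :
    ∫ w, powDensity p q f w ≤ (∫ w in {w | gaugeK w ≤ κ}, powDensity p q f w) +
      (κ ^ α)⁻¹ * ∫ w, powDensity p q f w * gaugeK w ^ α := by
  have hF := continuous_powDensity hp hq hf
  have hFc := hasCompactSupport_powDensity (p := p) hq hc
  have hm : MeasurableSet {w | gaugeK w ≤ κ} := (isClosed_gaugeK_le κ).measurableSet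
  have i0 : Integrable (powDensity p q f) := hF.integrable_of_hasCompactSupport hFc
  have iW : Integrable fun w => powDensity p q f w * gaugeK w ^ α :=
    (hF.mul (contDiff_gaugeK_rpow α).continuous).integrable_of_hasCompactSupport hFc.mul_right
  rw [← integral_indicator hm, ← integral_const_mul, ← integral_add (i0.indicator hm)
    (iW.const_mul _)]
  refine integral_mono i0 ((i0.indicator hm).add (iW.const_mul _)) fun w => ?_
  have h0 : 0 ≤ powDensity p q f w := by unfold powDensity; positivity
  have hK := gaugeK_pos w
  by_cases hw : gaugeK w ≤ κ
  · rw [indicator_of_mem (by simpa using hw)]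
    have : 0 ≤ (κ ^ α)⁻¹ * (powDensity p q f w * gaugeK w ^ α) := by positivity
    linarith
  · rw [indicator_of_notMem (by simpa using hw), zero_add, mul_left_comm]
    refine le_mul_of_one_le_right h0 ?_
    rw [← div_eq_inv_mul, one_le_div (by positivity)]
    exact Real.rpow_le_rpow hκ.le (not_le.1 hw).le hα

lemma one_add_rpow_le {x m : ℝ} (hx : 0 ≤ x) (hm : 0 ≤ m) :
    (1 + x) ^ m ≤ 2 ^ m * (1 + x ^ m) := by
  have hxm := Real.rpow_nonneg hx m
  have h2m : (0 : ℝ) < 2 ^ m := by positivity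
  rcases le_total x 1 with h | h
  · calc (1 + x) ^ m ≤ 2 ^ m := Real.rpow_le_rpow (by positivity) (by linarith) hm
      _ ≤ _ := le_mul_of_one_le_right h2m.le (by linarith)
  · calc (1 + x) ^ m ≤ (2 * x) ^ m := Real.rpow_le_rpow (by positivity) (by linarith) hm
      _ = 2 ^ m * x ^ m := Real.mul_rpow (by norm_num) hx
      _ ≤ _ := by gcongr; linarith

/-- Optimization of the parameters `κ` and `δ` in the decomposition into a gauge ball and its
complement. -/
lemma exists_parameters {p q α m A D : ℝ} (hq1 : 1 < q) (hq2 : q ≤ 2) (hα : 0 < α)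
    (hm : m = p / 4 / α) (hm1 : 1 ≤ m) (hA : 0 ≤ A) (hD : 0 ≤ D) :
    ∃ C, 0 ≤ C ∧ ∀ ε > (0 : ℝ), ∃ κ δ : ℝ, 0 < κ ∧ 0 < δ ∧ δ ≤ 1 ∧
      (κ ^ α)⁻¹ * A ≤ ε / 4 ∧ (κ ^ α)⁻¹ * D ≤ 1 / 4 ∧
      27 * (2 * δ) ^ q * Real.exp ((145 ^ 3 * κ) ^ (p / 4)) ≤ ε / 4 ∧
      4 * δ⁻¹ ^ 4 * Real.exp ((145 ^ 3 * κ) ^ (p / 4)) ^ 2 ≤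
        Real.exp (C * (1 + ε ^ (-m))) := by
  set B := 4 * A + 4 * D + 1 with hB
  have hB0 : 0 < B := by positivity
  set a := (145 ^ 3 : ℝ) ^ (p / 4) * B ^ m with ha
  have ha0 : 0 ≤ a := by positivity
  refine ⟨(6 * a + 34) * 2 ^ m, by positivity, fun ε hε => ?_⟩
  set T := 1 + ε⁻¹ with hT
  have hεi : 0 < ε⁻¹ := inv_pos.2 hε
  have hT1 : 1 ≤ T := by linarith
  have hTε : 1 ≤ ε * T := by rw [hT, mul_add, mul_inv_cancel₀ hε.ne']; linarith
  have hTm : T ≤ T ^ m := Real.self_le_rpow_of_one_le hT1 hm1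
  have hTm1 : 1 ≤ T ^ m := hT1.trans hTm
  set κ := (B * T) ^ α⁻¹ with hκ
  have hBT : 0 < B * T := by positivity
  have hκα : κ ^ α = B * T := by
    rw [hκ, ← Real.rpow_mul hBT.le, inv_mul_cancel₀ hα.ne', Real.rpow_one]
  have hL : (145 ^ 3 * κ) ^ (p / 4) = a * T ^ m := by
    rw [Real.mul_rpow (by positivity) (by positivity), hκ, ← Real.rpow_mul hBT.le,
      show α⁻¹ * (p / 4) = m by rw [hm]; ring, Real.mul_rpow hB0.le (by linarith), ha]
    ring
  refine ⟨κ, Real.exp (-((a + 8) * T ^ m)), by positivity, by positivity, ?_, ?_, ?_, ?_, ?_⟩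
  · exact Real.exp_le_one_iff.2 (by simp only [Left.neg_nonpos_iff]; positivity)
  · rw [hκα, ← div_eq_inv_mul, div_le_iff₀ hBT]
    nlinarith
  · rw [hκα, ← div_eq_inv_mul, div_le_iff₀ hBT]
    nlinarith
  · rw [hL]
    set δ := Real.exp (-((a + 8) * T ^ m)) with hδ
    have hδ0 : 0 < δ := Real.exp_pos _
    have hδ1 : δ ≤ 1 := Real.exp_le_one_iff.2 (by simp only [Left.neg_nonpos_iff]; positivity)
    have h1 : (2 * δ) ^ q ≤ 4 * δ := by
      rw [Real.mul_rpow (by norm_num) hδ0.le]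
      refine mul_le_mul ?_ ?_ (by positivity) (by norm_num)
      · calc (2 : ℝ) ^ q ≤ 2 ^ (2 : ℝ) := Real.rpow_le_rpow_of_exponent_le (by norm_num) hq2
          _ = 4 := by norm_num
      · calc δ ^ q ≤ δ ^ (1 : ℝ) := Real.rpow_le_rpow_of_exponent_ge hδ0 hδ1 hq1.le
          _ = δ := Real.rpow_one _
    have h2 : 432 * Real.exp (a * T ^ m) * T * δ ≤ 1 := by
      have e7 : (432 : ℝ) ≤ Real.exp (7 * T ^ m) := by
        calc (432 : ℝ) ≤ 2.7 ^ 7 := by norm_num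
          _ ≤ Real.exp 1 ^ 7 := by gcongr; linarith [Real.exp_one_gt_d9]
          _ = Real.exp 7 := by rw [← Real.exp_nat_mul]; norm_num
          _ ≤ _ := Real.exp_le_exp.2 (by linarith)
      have eT : T ≤ Real.exp (T ^ m) := by linarith [Real.add_one_le_exp (T ^ m)]
      calc _ ≤ Real.exp (7 * T ^ m) * Real.exp (a * T ^ m) * Real.exp (T ^ m) * δ := by gcongr
        _ = 1 := by
          rw [hδ, ← Real.exp_add, ← Real.exp_add, ← Real.exp_add, Real.exp_eq_one_iff]; ring
    have h3 : 0 < Real.exp (a * T ^ m) := Real.exp_pos _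
    have h4 : 27 * (2 * δ) ^ q * Real.exp (a * T ^ m) ≤ 27 * (4 * δ) * Real.exp (a * T ^ m) := by
      gcongr
    have h5 : 0 ≤ 432 * Real.exp (a * T ^ m) * δ := by positivity
    have h6 : 432 * Real.exp (a * T ^ m) * δ * 1 ≤ 432 * Real.exp (a * T ^ m) * δ * (ε * T) := by
      gcongr
    nlinarith
  · rw [hL, ← Real.exp_neg, neg_neg, ← Real.exp_nat_mul, ← Real.exp_nat_mul]
    have e4 : (4 : ℝ) ≤ Real.exp (2 * T ^ m) := by
      calc (4 : ℝ) ≤ 2.7 ^ 2 := by norm_num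
        _ ≤ Real.exp 1 ^ 2 := by gcongr; linarith [Real.exp_one_gt_d9]
        _ = Real.exp 2 := by rw [← Real.exp_nat_mul]; norm_num
        _ ≤ _ := Real.exp_le_exp.2 (by linarith)
    have hTe : T ^ m ≤ 2 ^ m * (1 + ε ^ (-m)) := by
      rw [Real.rpow_neg hε.le, ← Real.inv_rpow hε.le]
      exact one_add_rpow_le hεi.le (by linarith)
    calc _ ≤ Real.exp (2 * T ^ m) * Real.exp ((4 : ℕ) * ((a + 8) * T ^ m)) *
          Real.exp ((2 : ℕ) * (a * T ^ m)) := by gcongr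
      _ = Real.exp ((6 * a + 34) * T ^ m) := by
        rw [← Real.exp_add, ← Real.exp_add]; congr 1; push_cast; ring
      _ ≤ _ := by
        refine Real.exp_le_exp.2 ?_
        rw [mul_assoc]
        gcongr

/-- The super-Poincaré inequality for the unnormalized measure `e ^ (-N ^ p) dξ`. -/
lemma exists_integral_powDensity_le {p q : ℝ} (hp : 2 < p) (hq : q = p / (p - 1)) :
    ∃ C, 0 ≤ C ∧ ∀ ε > (0 : ℝ), ∀ f : ℝ × ℝ × ℝ → ℝ, ContDiff ℝ 1 f → HasCompactSupport f →
      ∫ w, powDensity p q f w ≤ ε * (∫ w, gradDensity p q f w) +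
        Real.exp (C * (1 + ε ^ (-(2 * (p - 1) / (p - 2))))) *
          (∫ w, powDensity p (q / 2) f w) ^ 2 := by
  have hp1 : 0 < p - 1 := by linarith
  have hp2 : 0 < p - 2 := by linarith
  have hq1 : 1 < q := by rw [hq, lt_div_iff₀ (by linarith)]; linarith
  have hq2 : q ≤ 2 := by rw [hq, div_le_iff₀ (by linarith)]; linarith
  set α := (p - 2) / 4 * q / 2 with hα
  have hα0 : 0 < α := by positivity
  obtain ⟨A, D, hA, hD, hW⟩ := exists_integral_powDensity_weight_le (α := α) hp hq rfl hα
  obtain ⟨C, hC, hpar⟩ := exists_parameters (p := p) (m := 2 * (p - 1) / (p - 2)) hq1 hq2 hα0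
    (by rw [hα, hq]; field_simp) (by rw [le_div_iff₀ hp2]; linarith) hA hD
  refine ⟨C, hC, fun ε hε f hf hc => ?_⟩
  obtain ⟨κ, δ, hκ, hδ0, hδ1, h1, h2, h3, h4⟩ := hpar ε hε
  have hsplit := integral_powDensity_le_split hp (by linarith : 0 < q) hα0.le hf.continuous hc hκ
  have hloc := setIntegral_powDensity_le (κ := κ) hp hq1 hq2 hf hc hδ0 hδ1
  have hI : 0 ≤ ∫ w, powDensity p q f w :=
    integral_nonneg fun w => by unfold powDensity; positivity
  have hG : 0 ≤ ∫ w, gradDensity p q f w :=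
    integral_nonneg fun w => by unfold gradDensity; positivity
  have hw := mul_le_mul_of_nonneg_left (hW f hf hc) (by positivity : 0 ≤ (κ ^ α)⁻¹)
  generalize (∫ w, powDensity p q f w) = I at *
  generalize (∫ w, gradDensity p q f w) = G at *
  generalize (∫ w, powDensity p (q / 2) f w) = H at *
  have g1 := mul_le_mul_of_nonneg_right h1 hG
  have g2 := mul_le_mul_of_nonneg_right h2 hI
  have g3 := mul_le_mul_of_nonneg_right h3 hG
  have g4 := mul_le_mul_of_nonneg_right h4 (sq_nonneg H)
  have g5 : 0 ≤ Real.exp (C * (1 + ε ^ (-(2 * (p - 1) / (p - 2))))) * H ^ 2 := by positivity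
  have g6 : 0 ≤ ε * G := by positivity
  rw [mul_pow] at hloc
  linarith

lemma integral_muH (p : ℝ) (g : ℝ × ℝ × ℝ → ℝ) :
    ∫ w, g w ∂(muH p) = (∫ v : ℝ × ℝ × ℝ, Real.exp (-(KaplanH v) ^ p))⁻¹ *
      ∫ w, g w * Real.exp (-(KaplanH w) ^ p) := by
  have hN : Measurable KaplanH := by unfold KaplanH; fun_prop
  have hZ : 0 ≤ ∫ v : ℝ × ℝ × ℝ, Real.exp (-(KaplanH v) ^ p) :=
    integral_nonneg fun v => (Real.exp_pos _).le
  unfold muH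
  rw [integral_withDensity_eq_integral_toReal_smul (by fun_prop)
    (ae_of_all _ fun w => ENNReal.ofReal_lt_top), ← integral_const_mul]
  refine integral_congr_ae (ae_of_all _ fun w => ?_)
  simp only [smul_eq_mul]
  rw [ENNReal.toReal_ofReal (by positivity)]
  ring
/-- The `q`-super-Poincaré inequality for `dμ = Z⁻¹ e^{-N^p} dξ` on the Heisenberg group,
`p > 2`, `q = p/(p-1)`, with growth function `β_q(ε) ∼ exp(C ε^{-2(p-1)/(p-2)})`:
`∫ |f|^q dμ ≤ ε ∫ |∇_ℍ f|^q dμ + exp(C(1 + ε^{-2(p-1)/(p-2)})) (∫ |f|^{q/2} dμ)²`. -/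
theorem spiq_heisenberg (p q : ℝ) (hp : 2 < p) (hq : q = p / (p - 1)) :
    ∃ C > 0, ∀ ε > (0 : ℝ),
      ∀ f : ℝ × ℝ × ℝ → ℝ, ContDiff ℝ (⊤ : ℕ∞) f → HasCompactSupport f →
      ∫ w, |f w| ^ q ∂(muH p) ≤
        ε * (∫ w, ((X1 f w) ^ 2 + (X2 f w) ^ 2) ^ (q / 2) ∂(muH p)) +
          Real.exp (C * (1 + ε ^ (-(2 * (p - 1) / (p - 2))))) *
            (∫ w, |f w| ^ (q / 2) ∂(muH p)) ^ 2 := by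
  obtain ⟨C, hC, h⟩ := exists_integral_powDensity_le hp hq
  simp only [integral_muH]
  set c := (∫ v : ℝ × ℝ × ℝ, Real.exp (-(KaplanH v) ^ p))⁻¹
  have hc0 : 0 ≤ c := inv_nonneg.2 (integral_nonneg fun v => (Real.exp_pos _).le)
  refine ⟨C + |Real.log c| + 1, by positivity, fun ε hε f hf hcs => ?_⟩
  have hI := h ε hε f (hf.of_le (by exact_mod_cast le_top)) hcs
  simp only [powDensity, gradDensity] at hI
  rcases hc0.eq_or_lt with hc | hc
  · simp [← hc]
  have hx : 0 < ε ^ (-(2 * (p - 1) / (p - 2))) := by positivity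
  generalize ε ^ (-(2 * (p - 1) / (p - 2))) = x at *
  have hexp : Real.exp (C * (1 + x)) ≤ Real.exp ((C + |Real.log c| + 1) * (1 + x)) * c := by
    nth_rewrite 2 [← Real.exp_log hc]
    rw [← Real.exp_add, Real.exp_le_exp]
    nlinarith [neg_abs_le (Real.log c), abs_nonneg (Real.log c)]
  have h1 := mul_le_mul_of_nonneg_left hI hc0
  have h2 := mul_le_mul_of_nonneg_right hexp
    (mul_nonneg hc0 (sq_nonneg (∫ w, |f w| ^ (q / 2) * Real.exp (-(KaplanH w) ^ p))))
  linarith
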